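/- For every communication bound f among O(1), O(log n), O(√n), O(n), the class of languages accepted by reversible two-party Watson-Crick systems with communication bound f is strictly contained in the class accepted by general (possibly irreversible) deterministic two-party Watson-Crick systems with communication bound f. -/

import Mathlib

namespace WK

/-- Tape symbols: input symbols plus the two endmarkers.
`Sum.inr false` is the left endmarker, `Sum.inr true` the right endmarker. -/
abbrev TSym (α : Type) : Type := α ⊕ Bool

/-- The tape for input `w`: left endmarker, the symbols of `w`, right endmarker. -/
def tape {α : Type} (w : List α) (k : ℕ) : TSym α :=
  ((Sum.inr false :: w.map Sum.inl) ++ [Sum.inr true]).getD k (Sum.inr true)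

/-- A deterministic two-party Watson-Crick system: two finite automata (the upper
component `1` and the lower component `2`) with a finite set `M` of messages,
partial transition functions `δᵢ` (depending on state, scanned symbol and received
message, `none` = no message) and broadcast functions `μᵢ`. -/
structure DPWK (α : Type) where
  M : Type
  Q1 : Type
  Q2 : Type
  fM : Fintype M
  fQ1 : Fintype Q1
  fQ2 : Fintype Q2
  δ1 : Q1 → TSym α → Option M → Option (Q1 × Bool)
  δ2 : Q2 → TSym α → Option M → Option (Q2 × Bool)
  μ1 : Q1 → TSym α → Option M
  μ2 : Q2 → TSym α → Option M
  q01 : Q1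
  q02 : Q2
  F1 : Set Q1
  F2 : Set Q2

/-- A configuration: states and head positions of the two components. -/
structure Config {α : Type} (A : DPWK α) where
  p : A.Q1
  i : ℕ
  q : A.Q2
  j : ℕ

/-- One synchronous (forward) computation step: each component reads its symbol,
receives the message broadcast by the other component, changes its state and
optionally moves (the upper head to the right, the lower head to the left). -/
def Step {α : Type} (A : DPWK α) (w : List α) (c c' : Config A) : Prop :=
  ∃ d1 d2 : Bool,
    A.δ1 c.p (tape w c.i) (A.μ2 c.q (tape w c.j)) = some (c'.p, d1) ∧
    A.δ2 c.q (tape w c.j) (A.μ1 c.p (tape w c.i)) = some (c'.q, d2) ∧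
    c'.i = c.i + (cond d1 1 0) ∧ c.j = c'.j + (cond d2 1 0)

/-- The initial configuration on input `w`: the upper component on the left
endmarker, the lower component on the right endmarker. -/
def initConf {α : Type} (A : DPWK α) (w : List α) : Config A :=
  ⟨A.q01, 0, A.q02, w.length + 1⟩

/-- The system halts in `c` if no successor configuration exists. -/
def Halted {α : Type} (A : DPWK α) (w : List α) (c : Config A) : Prop :=
  ¬ ∃ c', Step A w c c'

/-- A configuration is accepting if at least one component is in an accepting state. -/
def AccConf {α : Type} (A : DPWK α) (c : Config A) : Prop :=
  c.p ∈ A.F1 ∨ c.q ∈ A.F2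

/-- `cs` is an accepting computation of `A` on `w`: it starts in the initial
configuration, follows the step relation, and ends in a halting configuration
with at least one component in an accepting state. -/
def AccComp {α : Type} (A : DPWK α) (w : List α) (cs : List (Config A)) : Prop :=
  cs.head? = some (initConf A w) ∧ List.Chain' (Step A w) cs ∧
    ∃ c, cs.getLast? = some c ∧ Halted A w c ∧ AccConf A c

def Accepts {α : Type} (A : DPWK α) (w : List α) : Prop := ∃ cs, AccComp A w cs

/-- The language accepted by `A`. -/
def lang {α : Type} (A : DPWK α) : Set (List α) := { w | Accepts A w }

/-- One backward computation step, induced by reverse transition functions `δ'ᵢ` and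
reverse broadcast functions `μ'ᵢ`: the heads first move to their predecessor
positions (the upper head left, the lower head right) and then read the symbols there. -/
def BackStep {α : Type} (A : DPWK α)
    (δ'1 : A.Q1 → TSym α → Option A.M → Option (A.Q1 × Bool))
    (δ'2 : A.Q2 → TSym α → Option A.M → Option (A.Q2 × Bool))
    (μ'1 : A.Q1 → TSym α → Option A.M)
    (μ'2 : A.Q2 → TSym α → Option A.M)
    (w : List α) (c' c : Config A) : Prop :=
  ∃ d1 d2 : Bool,
    δ'1 c'.p (tape w c.i) (μ'2 c'.q (tape w c.j)) = some (c.p, d1) ∧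
    δ'2 c'.q (tape w c.j) (μ'1 c'.p (tape w c.i)) = some (c.q, d2) ∧
    c'.i = c.i + (cond d1 1 0) ∧ c.j = c'.j + (cond d2 1 0)

/-- A witness of reversibility: reverse transition and broadcast functions whose
induced backward step relation is exactly the inverse of the forward step relation,
so every configuration has at most one predecessor, computable by such a system. -/
structure RevWitness {α : Type} (A : DPWK α) where
  δ'1 : A.Q1 → TSym α → Option A.M → Option (A.Q1 × Bool)
  δ'2 : A.Q2 → TSym α → Option A.M → Option (A.Q2 × Bool)
  μ'1 : A.Q1 → TSym α → Option A.M
  μ'2 : A.Q2 → TSym α → Option A.M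
  inverse : ∀ (w : List α) (c c' : Config A),
    BackStep A δ'1 δ'2 μ'1 μ'2 w c' c ↔ Step A w c c'

/-- A reversible deterministic two-party Watson-Crick system (REV-PWK). -/
def Reversible {α : Type} (A : DPWK α) : Prop := Nonempty (RevWitness A)

/-- Number of messages (`0`, `1` or `2`) broadcast in one step from configuration `c`,
with respect to broadcast functions `μ1`, `μ2`. -/
def stepMsgs {α : Type} (A : DPWK α)
    (μ1 : A.Q1 → TSym α → Option A.M) (μ2 : A.Q2 → TSym α → Option A.M)
    (w : List α) (c : Config A) : ℕ :=
  ((μ1 c.p (tape w c.i)).elim 0 fun _ => 1) + ((μ2 c.q (tape w c.j)).elim 0 fun _ => 1)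

/-- Total number of messages sent during the computation `cs` (no messages are
sent from the final, halting configuration). -/
def commCount {α : Type} (A : DPWK α)
    (μ1 : A.Q1 → TSym α → Option A.M) (μ2 : A.Q2 → TSym α → Option A.M)
    (w : List α) (cs : List (Config A)) : ℕ :=
  (cs.dropLast.map (stepMsgs A μ1 μ2 w)).sum

/-- `A` is a reversible system that is communication bounded by `f`: it is reversible
and every word of its language is accepted by a computation in which the number of
messages sent in the forward computation and in the reverse computation are each at
most `f` of the input length. -/
def RevCommBounded {α : Type} (A : DPWK α) (f : ℕ → ℕ) : Prop :=
  ∃ Wit : RevWitness A, ∀ w ∈ lang A, ∃ cs, AccComp A w cs ∧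
    commCount A A.μ1 A.μ2 w cs ≤ f w.length ∧
    commCount A Wit.μ'1 Wit.μ'2 w cs.reverse ≤ f w.length

/-- `A` (not necessarily reversible) is communication bounded by `f`. -/
def CommBounded {α : Type} (A : DPWK α) (f : ℕ → ℕ) : Prop :=
  ∀ w ∈ lang A, ∃ cs, AccComp A w cs ∧ commCount A A.μ1 A.μ2 w cs ≤ f w.length

/-- The family of languages accepted by reversible deterministic two-party
Watson-Crick systems over the alphabet `α`. -/
def RevPWKLangs (α : Type) : Set (Set (List α)) :=
  { L | ∃ A : DPWK α, Reversible A ∧ lang A = L }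

/-- Languages accepted by REV-PWKs with `O(f)` communication. -/
def RevPWKLangsO (α : Type) (f : ℕ → ℕ) : Set (Set (List α)) :=
  { L | ∃ (A : DPWK α) (C : ℕ),
      RevCommBounded A (fun n => C * f n + C) ∧ lang A = L }

/-- Languages accepted by (possibly irreversible) DPWKs with `O(f)` communication. -/
def PWKLangsO (α : Type) (f : ℕ → ℕ) : Set (Set (List α)) :=
  { L | ∃ (A : DPWK α) (C : ℕ),
      CommBounded A (fun n => C * f n + C) ∧ lang A = L }

end WK

namespace WKP

open Finset

/-- Abstract synchronous two-head machine. -/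
abbrev Mach (S Z : Type) := S → S → Z → Option (Z × Bool × Bool)

variable {S Z : Type}

def run (F : Mach S Z) (a b : ℕ → S) : ℕ → Z → ℕ → ℕ → Option (Z × ℕ × ℕ)
  | 0, z, i, j => some (z, i, j)
  | n + 1, z, i, j =>
    (F (a i) (b j) z).bind fun r => run F a b n r.1 (i + r.2.1.toNat) (j + r.2.2.toNat)

@[simp] theorem run_zero (F : Mach S Z) (a b : ℕ → S) (z i j) :
    run F a b 0 z i j = some (z, i, j) := rfl

theorem run_succ (F : Mach S Z) (a b : ℕ → S) (n z i j c) :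
    run F a b (n+1) z i j = some c ↔ ∃ z' d e, F (a i) (b j) z = some (z', d, e) ∧
      run F a b n z' (i + d.toNat) (j + e.toNat) = some c := by
  simp [run, Option.bind_eq_some_iff]

theorem run_one (F : Mach S Z) (a b : ℕ → S) {z i j z' d e}
    (h : F (a i) (b j) z = some (z', d, e)) :
    run F a b 1 z i j = some (z', i + d.toNat, j + e.toNat) := by
  rw [run_succ]; exact ⟨z', d, e, h, rfl⟩

theorem run_add (F : Mach S Z) (a b : ℕ → S) (n k z i j c) :
    run F a b (n+k) z i j = some c ↔ ∃ z' i' j', run F a b n z i j = some (z', i', j') ∧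
      run F a b k z' i' j' = some c := by
  induction n generalizing z i j with
  | zero => simp
  | succ n ih =>
    rw [show n + 1 + k = (n + k) + 1 by omega, run_succ]
    constructor
    · rintro ⟨z', d, e, h, h2⟩
      obtain ⟨z1, i1, j1, h3, h4⟩ := (ih _ _ _).1 h2
      exact ⟨z1, i1, j1, (run_succ ..).2 ⟨z', d, e, h, h3⟩, h4⟩
    · rintro ⟨z1, i1, j1, h3, h4⟩
      obtain ⟨z', d, e, h, h2⟩ := (run_succ ..).1 h3
      exact ⟨z', d, e, h, (ih _ _ _).2 ⟨_, _, _, h2, h4⟩⟩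

theorem run_trans {F : Mach S Z} {a b : ℕ → S} {n k z i j z' i' j' c}
    (h1 : run F a b n z i j = some (z', i', j')) (h2 : run F a b k z' i' j' = some c) :
    run F a b (n+k) z i j = some c := (run_add ..).2 ⟨_, _, _, h1, h2⟩

theorem run_rest {F : Mach S Z} {a b : ℕ → S} {n k z i j z' i' j' c} (hk : k ≤ n)
    (h1 : run F a b n z i j = some c) (h2 : run F a b k z i j = some (z', i', j')) :
    run F a b (n-k) z' i' j' = some c := by
  obtain ⟨r, rfl⟩ := Nat.exists_eq_add_of_le hk
  obtain ⟨_, _, _, h3, h4⟩ := (run_add ..).1 h1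
  rw [h2] at h3
  simp only [Option.some.injEq, Prod.mk.injEq] at h3
  obtain ⟨rfl, rfl, rfl⟩ := h3
  simpa using h4

theorem run_upto {F : Mach S Z} {a b : ℕ → S} {n k z i j c} (hk : k ≤ n)
    (h1 : run F a b n z i j = some c) : ∃ z' i' j', run F a b k z i j = some (z', i', j') ∧
      run F a b (n-k) z' i' j' = some c := by
  obtain ⟨r, rfl⟩ := Nat.exists_eq_add_of_le hk
  obtain ⟨_, _, _, h3, h4⟩ := (run_add ..).1 h1
  exact ⟨_, _, _, h3, by simpa using h4⟩

theorem run_mono {F : Mach S Z} {a b : ℕ → S} {n z i j z' i' j'}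
    (h : run F a b n z i j = some (z', i', j')) :
    i ≤ i' ∧ j ≤ j' ∧ i' ≤ i + n ∧ j' ≤ j + n := by
  induction n generalizing z i j with
  | zero => simp at h; omega
  | succ n ih =>
    obtain ⟨z1, d, e, _, h2⟩ := (run_succ ..).1 h
    have := ih h2
    have := d.toNat_le; have := e.toNat_le
    omega

/-- Translation. -/
theorem run_congr {F : Mach S Z} {a b a' b' : ℕ → S} {n z i j z1 i1 j1} (i' j' : ℕ)
    (h : run F a b n z i j = some (z1, i1, j1))
    (ha : ∀ q, i + q ≤ i1 → a (i+q) = a' (i'+q)) (hb : ∀ q, j + q ≤ j1 → b (j+q) = b' (j'+q)) :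
    run F a' b' n z i' j' = some (z1, i' + (i1 - i), j' + (j1 - j)) := by
  induction n generalizing z i j i' j' with
  | zero => simp at h; obtain ⟨rfl, rfl, rfl⟩ := h; simp
  | succ n ih =>
    obtain ⟨z2, d, e, hF, h2⟩ := (run_succ ..).1 h
    have hm := run_mono h2
    refine (run_succ ..).2 ⟨z2, d, e, ?_, ?_⟩
    · have h3 := ha 0 (by omega); have h4 := hb 0 (by omega)
      simp only [add_zero] at h3 h4; rw [← h3, ← h4]; exact hF
    · have := ih (i' + d.toNat) (j' + e.toNat) h2
        (fun q hq => by have := ha (d.toNat + q) (by omega); simpa [add_assoc] using this)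
        (fun q hq => by have := hb (e.toNat + q) (by omega); simpa [add_assoc] using this)
      rw [this]; simp only [Option.some.injEq, Prod.mk.injEq, true_and]; omega

theorem run_cross {F : Mach S Z} {a b : ℕ → S} {n z i j z1 i1 j1} (p : ℕ)
    (h : run F a b n z i j = some (z1, i1, j1)) (h1 : i ≤ p) (h2 : p < i1) :
    ∃ n0 z0 j0 z' e, n0 < n ∧ run F a b n0 z i j = some (z0, p, j0) ∧
      F (a p) (b j0) z0 = some (z', true, e) ∧
      run F a b (n - n0 - 1) z' (p+1) (j0 + e.toNat) = some (z1, i1, j1) := by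
  induction n generalizing z i j with
  | zero => simp at h; omega
  | succ n ih =>
    obtain ⟨z2, d, e, hF, hr⟩ := (run_succ ..).1 h
    by_cases hp : i + d.toNat ≤ p
    · obtain ⟨n0, z0, j0, z', e', hn, h3, h4, h5⟩ := ih hr hp
      exact ⟨n0+1, z0, j0, z', e', by omega, (run_succ ..).2 ⟨z2, d, e, hF, h3⟩, h4, by
        rw [show n + 1 - (n0 + 1) - 1 = n - n0 - 1 by omega]; exact h5⟩
    · have hd : d = true := by cases d <;> simp at hp ⊢; omega
      subst hd
      have : i = p := by simp at hp; omega
      subst this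
      exact ⟨0, z, j, z2, e, by omega, rfl, hF, by simpa using hr⟩

/-- Exchange the two heads. -/
def swF (F : Mach S Z) : Mach S Z := fun s t z => (F t s z).map fun r => (r.1, r.2.2, r.2.1)

theorem swF_some (F : Mach S Z) {s t z z' d e} :
    swF F s t z = some (z', e, d) ↔ F t s z = some (z', d, e) := by
  simp only [swF, Option.map_eq_some_iff, Prod.mk.injEq, Prod.exists]
  constructor
  · rintro ⟨_, _, _, h, rfl, rfl, rfl⟩; exact h
  · intro h; exact ⟨_, _, _, h, rfl, rfl, rfl⟩

theorem swF_none (F : Mach S Z) {s t z} : swF F s t z = none ↔ F t s z = none := by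
  simp [swF]

theorem run_sw (F : Mach S Z) (a b : ℕ → S) {n z i j z1 i1 j1} :
    run (swF F) b a n z j i = some (z1, j1, i1) ↔ run F a b n z i j = some (z1, i1, j1) := by
  induction n generalizing z i j with
  | zero => simp; tauto
  | succ n ih =>
    rw [run_succ, run_succ]
    constructor
    · rintro ⟨z', d, e, h, h2⟩; exact ⟨z', e, d, (swF_some F).1 h, ih.1 h2⟩
    · rintro ⟨z', d, e, h, h2⟩; exact ⟨z', e, d, (swF_some F).2 h, ih.2 h2⟩

/-- injectivity of the state map for fixed symbols -/
def Inj (F : Mach S Z) : Prop := ∀ s t z1 z2 z' d e d' e',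
  F s t z1 = some (z', d, e) → F s t z2 = some (z', d', e') → z1 = z2

theorem Inj.sw {F : Mach S Z} (h : Inj F) : Inj (swF F) := by
  intro s t z1 z2 z' d e d' e' h1 h2
  exact h t s z1 z2 z' _ _ _ _ ((swF_some F).1 h1) ((swF_some F).1 h2)

/-! Constant world -/

def K (s : S) : ℕ → S := fun _ => s

theorem run_const_shift {F : Mach S Z} {s t : S} {n z i j z1 i1 j1} (i' j' : ℕ)
    (h : run F (K s) (K t) n z i j = some (z1, i1, j1)) :
    run F (K s) (K t) n z i' j' = some (z1, i' + (i1 - i), j' + (j1 - j)) :=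
  run_congr i' j' h (fun _ _ => rfl) (fun _ _ => rfl)

theorem run_inj {F : Mach S Z} (hF : Inj F) {s t : S} {n z1 z2 i1 j1 i2 j2 z' i1' j1' i2' j2'}
    (h1 : run F (K s) (K t) n z1 i1 j1 = some (z', i1', j1'))
    (h2 : run F (K s) (K t) n z2 i2 j2 = some (z', i2', j2')) : z1 = z2 := by
  induction n generalizing z' i1' j1' i2' j2' with
  | zero => simp at h1 h2; rw [h1.1, h2.1]
  | succ n ih =>
    obtain ⟨x1, _, _, h3, h4⟩ := (run_add ..).1 h1
    obtain ⟨x2, _, _, h5, h6⟩ := (run_add ..).1 h2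
    obtain ⟨_, _, _, h7, h8⟩ := (run_succ ..).1 h4
    obtain ⟨_, _, _, h9, h10⟩ := (run_succ ..).1 h6
    simp only [run_zero, Option.some.injEq, Prod.mk.injEq] at h8 h10
    obtain ⟨rfl, _⟩ := h8
    obtain ⟨rfl, _⟩ := h10
    have := hF _ _ _ _ _ _ _ _ _ h7 h9
    subst this
    exact ih h3 h5

/-- Pigeonhole: a run of `N = card Z` steps repeats a state. -/
theorem run_pigeon [Fintype Z] {F : Mach S Z} {a b : ℕ → S} {n z i j c}
    (hn : Fintype.card Z ≤ n) (h : run F a b n z i j = some c) :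
    ∃ n1 T zz i1 j1 i2 j2, 1 ≤ T ∧ n1 + T ≤ Fintype.card Z ∧
      run F a b n1 z i j = some (zz, i1, j1) ∧ run F a b T zz i1 j1 = some (zz, i2, j2) := by
  have hex : ∀ k : Fin (Fintype.card Z + 1), ∃ x, run F a b k z i j = some x := by
    intro k
    obtain ⟨x, y, w, h1, _⟩ := run_upto (k := k) (by omega) h
    exact ⟨_, h1⟩
  choose g hg using hex
  obtain ⟨k1, k2, hne, heq⟩ := Fintype.exists_ne_map_eq_of_card_lt (fun k => (g k).1) (by simp)
  have key : ∀ k1 k2 : Fin (Fintype.card Z + 1), k1 < k2 → (g k1).1 = (g k2).1 →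
     ∃ n1 T zz i1 j1 i2 j2, 1 ≤ T ∧ n1 + T ≤ Fintype.card Z ∧
      run F a b n1 z i j = some (zz, i1, j1) ∧ run F a b T zz i1 j1 = some (zz, i2, j2) := by
    intro k1 k2 hlt heq
    refine ⟨k1, k2 - k1, (g k1).1, (g k1).2.1, (g k1).2.2, (g k2).2.1, (g k2).2.2, ?_, ?_, ?_, ?_⟩
    · have : k1.1 < k2.1 := hlt
      omega
    · have : k1.1 < k2.1 := hlt
      omega
    · exact hg k1
    · refine run_rest (le_of_lt hlt) ?_ (hg k1)
      rw [heq]; exact hg k2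
  rcases lt_or_gt_of_ne hne with h1 | h1
  · exact key _ _ h1 heq
  · exact key _ _ h1 heq.symm

/-- Periodicity: a long run in a constant world returns to its start state. -/
theorem run_period [Fintype Z] {F : Mach S Z} (hF : Inj F) {s t : S} {n z i j c}
    (hn : Fintype.card Z ≤ n) (h : run F (K s) (K t) n z i j = some c) :
    ∃ T d e, 1 ≤ T ∧ T ≤ Fintype.card Z ∧ d ≤ T ∧ e ≤ T ∧
      ∀ i j, run F (K s) (K t) T z i j = some (z, i + d, j + e) := by
  obtain ⟨n1, T, zz, i1, j1, i2, j2, h1, h2, h3, h4⟩ := run_pigeon hn h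
  obtain ⟨z', i', j', h5, h6⟩ := run_upto (k := T) (by omega) h
  have h7 := run_trans h3 h4
  rw [add_comm] at h7
  have h8 := run_rest (by omega) h7 h5
  rw [Nat.add_sub_cancel_left] at h8
  have := run_inj hF h3 h8
  subst this
  have hm := run_mono h5
  refine ⟨T, i' - i, j' - j, h1, by omega, by omega, by omega, fun i j => run_const_shift i j h5⟩

theorem run_iter {F : Mach S Z} {s t : S} {T z d e}
    (h : ∀ i j, run F (K s) (K t) T z i j = some (z, i + d, j + e)) (q i j : ℕ) :
    run F (K s) (K t) (q * T) z i j = some (z, i + q * d, j + q * e) := by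
  induction q generalizing i j with
  | zero => simp
  | succ q ih =>
    rw [show (q+1) * T = T + q * T by ring, show i + (q+1) * d = i + d + q * d by ring,
      show j + (q+1) * e = j + e + q * e by ring]
    exact run_trans (h i j) (ih _ _)

theorem cl_add {F : Mach S Z} {s t : S} {T z d e n zp X Y}
    (h : ∀ i j, run F (K s) (K t) T z i j = some (z, i + d, j + e))
    (hr : run F (K s) (K t) n z 0 0 = some (zp, X, Y)) (q : ℕ) :
    run F (K s) (K t) (q * T + n) z 0 0 = some (zp, X + q * d, Y + q * e) := by
  have h1 := run_iter h q 0 0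
  have h2 := run_const_shift (0 + q * d) (0 + q * e) hr
  have := run_trans h1 h2
  rw [this]; simp; omega

theorem cl_sub {F : Mach S Z} {s t : S} {T z d e n zp X Y z' f}
    (h : ∀ i j, run F (K s) (K t) T z i j = some (z, i + d, j + e))
    (hr : run F (K s) (K t) n z 0 0 = some (zp, X, Y))
    (hnext : F s t zp = some (z', true, f)) (q : ℕ) (hq : q * d ≤ X) :
    q * e ≤ Y ∧ run F (K s) (K t) (n - q * T) z 0 0 = some (zp, X - q * d, Y - q * e) := by
  have h1 := run_iter h q 0 0
  have hle : q * T ≤ n := by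
    by_contra hlt
    push Not at hlt
    have h2 : run F (K s) (K t) (n+1) z 0 0 = some (z', X + 1, Y + f.toNat) :=
      run_trans hr (run_one F (K s) (K t) (i := X) (j := Y) hnext)
    have h3 := run_rest (by omega : n + 1 ≤ q * T) h1 h2
    have := run_mono h3
    omega
  have h2 := run_rest hle hr h1
  have h3 := run_const_shift 0 0 h2
  have := run_mono h2
  refine ⟨by omega, ?_⟩
  rw [h3]; simp

/-- In a constant world, after reaching a loop without head-1 movement, and starting anywhere
before, head 1 did not move. -/
theorem back_inj {F : Mach S Z} (hF : Inj F) {s t : S} {r z z1 X Y T d}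
    (h1 : run F (K s) (K t) r z 0 0 = some (z1, X, Y)) (hT : 1 ≤ T)
    (h2 : ∀ i j, run F (K s) (K t) T z1 i j = some (z1, i, j + d)) : X = 0 := by
  have h3 := run_iter (d := 0) (by simpa using h2) r 0 0
  have hle : r ≤ r * T := Nat.le_mul_of_pos_right _ hT
  obtain ⟨z2, i2, j2, h4, h5⟩ := run_upto (k := r * T - r) (by omega) h3
  rw [show r * T - (r * T - r) = r by omega] at h5
  have := run_inj hF h1 h5
  subst this
  have h6 := run_const_shift 0 0 h5
  rw [h1] at h6
  simp only [Option.some.injEq, Prod.mk.injEq] at h6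
  have := run_mono h5
  simp at this
  omega

/-- In a loop without head-1 movement everything is defined and head 1 never moves. -/
theorem loop_run {F : Mach S Z} {s t : S} {z T d}  (hT : 1 ≤ T)
    (h2 : ∀ i j, run F (K s) (K t) T z i j = some (z, i, j + d)) (n i j : ℕ) :
    ∃ z' j', run F (K s) (K t) n z i j = some (z', i, j') ∧
      (∃ z'' e, F s t z' = some (z'', false, e)) := by
  have h3 := run_iter (d := 0) (by simpa using h2) (n+1) i j
  have hle : n + 1 ≤ (n+1) * T := Nat.le_mul_of_pos_right _ hT
  obtain ⟨z2, i2, j2, h4, h5⟩ := run_upto (k := n) (by omega) h3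
  have e1 := run_mono h4
  have e2 := run_mono h5
  have : i2 = i := by simp at e2; omega
  subst this
  obtain ⟨w, hw⟩ := Nat.exists_eq_succ_of_ne_zero (show (n+1)*T - n ≠ 0 by omega)
  rw [hw] at h5
  obtain ⟨z3, d', e, h6, h7⟩ := (run_succ ..).1 h5
  have e3 := run_mono h7
  refine ⟨z2, j2, h4, z3, e, ?_⟩
  cases d'
  · exact h6
  · simp at e3

end WKP

namespace WKP

open Finset

variable {S Z : Type}

/-- start of run `k` when run `r` has length `1 + κ * u r` -/
def Bd (κ : ℕ) (u : ℕ → ℕ) (k : ℕ) : ℕ := ∑ r ∈ range k, (1 + κ * u r)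

theorem Bd_succ (κ : ℕ) (u : ℕ → ℕ) (k : ℕ) : Bd κ u (k+1) = Bd κ u k + (1 + κ * u k) := by
  simp [Bd, sum_range_succ]

@[simp] theorem Bd_zero (κ : ℕ) (u : ℕ → ℕ) : Bd κ u 0 = 0 := by simp [Bd]

theorem Bd_strictMono (κ : ℕ) (u : ℕ → ℕ) : StrictMono (Bd κ u) :=
  strictMono_nat_of_lt_succ fun k => by rw [Bd_succ]; omega

theorem Bd_le {κ : ℕ} {u : ℕ → ℕ} {k l : ℕ} (h : k ≤ l) : Bd κ u k ≤ Bd κ u l :=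
  (Bd_strictMono κ u).monotone h

theorem Bd_dec (κ : ℕ) (u : ℕ → ℕ) (i : ℕ) : ∃ k x, i = Bd κ u k + x ∧ x < 1 + κ * u k := by
  induction i with
  | zero => exact ⟨0, 0, by simp, by omega⟩
  | succ i ih =>
    obtain ⟨k, x, h1, h2⟩ := ih
    by_cases h : x + 1 < 1 + κ * u k
    · exact ⟨k, x+1, by omega, h⟩
    · exact ⟨k+1, 0, by rw [Bd_succ]; omega, by omega⟩

theorem Bd_uniq {κ : ℕ} {u : ℕ → ℕ} {k x l y : ℕ} (h : Bd κ u k + x = Bd κ u l + y)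
    (hx : x < 1 + κ * u k) (hy : y < 1 + κ * u l) : k = l ∧ x = y := by
  have h1 := Bd_succ κ u k
  have h2 := Bd_succ κ u l
  rcases lt_trichotomy k l with h3 | h3 | h3
  · have := Bd_le (κ := κ) (u := u) (Nat.succ_le_of_lt h3); simp at this; omega
  · subst h3; omega
  · have := Bd_le (κ := κ) (u := u) (Nat.succ_le_of_lt h3); simp at this; omega

theorem Bd_idx_le {κ : ℕ} {u : ℕ → ℕ} {k x l y : ℕ} (h : Bd κ u k + x ≤ Bd κ u l + y)
    (hy : y < 1 + κ * u l) : k ≤ l := by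
  by_contra h3
  have h2 := Bd_succ κ u l
  have := Bd_le (κ := κ) (u := u) (show l + 1 ≤ k by omega); omega

/-- the tape `a` is run-length described by symbols `sy` and lengths `u` -/
def RL (κ : ℕ) (a : ℕ → S) (sy : ℕ → S) (u : ℕ → ℕ) : Prop :=
  ∀ k x, x < 1 + κ * u k → a (Bd κ u k + x) = sy k

structure Md (U U' : ℕ → ℕ) (p q : ℕ) : Prop where
  ne : p ≠ q
  up : U p = 1
  uq : U q = 1
  up' : U' p = 0
  uq' : U' q = 2
  eq : ∀ r, r ≠ p → r ≠ q → U' r = U r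

section
variable [Fintype Z]

/-- the scale -/
def kap (Z : Type) [Fintype Z] : ℕ := (Fintype.card Z).factorial ^ 2

theorem kap_pos : 0 < kap Z := by unfold kap; positivity

theorem card_le_kap : Fintype.card Z ≤ kap Z := by
  unfold kap
  have h1 := Nat.self_le_factorial (Fintype.card Z)
  have h2 := Nat.factorial_pos (Fintype.card Z)
  nlinarith

theorem cl_cross {F : Mach S Z} (hF : Inj F) {s t : S} {n z zp U Y z' f} (hU : 1 ≤ U)
    (hr : run F (K s) (K t) n z 0 0 = some (zp, kap Z * U, Y))
    (hnext : F s t zp = some (z', true, f)) :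
    ∃ σ, σ ≤ kap Z * Fintype.card Z ∧ (Fintype.card Z).factorial ∣ σ ∧
      ∀ u, ∃ n' Y', run F (K s) (K t) n' z 0 0 = some (zp, kap Z * u, Y') ∧
        Y' + U * σ = Y + u * σ := by
  have hm := run_mono hr
  have hk : kap Z ≤ kap Z * U := Nat.le_mul_of_pos_right _ hU
  have := card_le_kap (Z := Z)
  obtain ⟨T, d, e, h1, h2, h3, h4, h5⟩ := run_period hF (by omega) hr
  have hd : 0 < d := by
    rcases Nat.eq_zero_or_pos d with rfl | hd
    · obtain ⟨z2, j2, h6, z3, e3, h7⟩ := loop_run h1 (by simpa using h5) n 0 0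
      rw [hr] at h6
      have := kap_pos (Z := Z)
      simp at h6; omega
    · exact hd
  have hdf : d ∣ (Fintype.card Z).factorial := Nat.dvd_factorial hd (by omega)
  obtain ⟨c, hc⟩ := hdf
  set g := (Fintype.card Z).factorial with hg
  have hkap : kap Z = (c * g) * d := by unfold kap; rw [← hg, pow_two]; nth_rewrite 1 [hc]; ring
  refine ⟨c * g * e, ?_, ⟨c * e, by ring⟩, fun u => ?_⟩
  · have h7 : c * g ≤ kap Z := by rw [hkap]; exact Nat.le_mul_of_pos_right _ hd
    exact Nat.mul_le_mul h7 (by omega)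
  · rcases le_total U u with h | h
    · obtain ⟨q, rfl⟩ := Nat.exists_eq_add_of_le h
      have := cl_add h5 hr (q * (c * g))
      refine ⟨_, Y + q * (c * g) * e, this.trans ?_, by ring⟩
      rw [hkap]; congr 3; ring
    · obtain ⟨q, rfl⟩ := Nat.exists_eq_add_of_le h
      have := cl_sub h5 hr hnext (q * (c * g)) (by rw [hkap]; nlinarith)
      refine ⟨_, Y - q * (c * g) * e, this.2.trans ?_, ?_⟩
      · rw [hkap]; congr 3
        rw [Nat.sub_eq_iff_eq_add (by nlinarith)]; ring
      · have h8 := this.1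
        zify [h8]; push_cast; ring

/-- one-head transfer: head 2 reads a constant symbol -/
theorem OH {F : Mach S Z} (hF : Inj F) {t : S} {a : ℕ → S} {sy : ℕ → S} {U : ℕ → ℕ}
    (hRL : RL (kap Z) a sy U) (D : ℕ) : ∀ {k k1 n z x j z1 x1 j1}, k1 = k + D →
    run F a (K t) n z (Bd (kap Z) U k + x) j = some (z1, Bd (kap Z) U k1 + x1, j1) →
    x < 1 + kap Z * U k → x1 < 1 + kap Z * U k1 →
    ∃ σ : ℕ → ℕ, (∀ r, σ r ≤ kap Z * Fintype.card Z ∧ (Fintype.card Z).factorial ∣ σ r) ∧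
      (∀ r, r < k → σ r = 0) ∧
      ∀ U' a' p q, RL (kap Z) a' sy U' → Md U U' p q → ((k = p ∨ k = q) → x = 0) →
        ((k1 = p ∨ k1 = q) → x1 = 0) → ∀ j', ∃ n' j1',
        run F a' (K t) n' z (Bd (kap Z) U' k + x) j' = some (z1, Bd (kap Z) U' k1 + x1, j1') ∧
        j1' + j + σ p = j1 + j' + σ q := by
  induction D with
  | zero =>
    intro k k1 n z x j z1 x1 j1 hk h hx hx1
    simp only [add_zero] at hk
    subst hk
    have hm := run_mono h
    refine ⟨fun _ => 0, fun _ => ⟨Nat.zero_le _, dvd_zero _⟩, fun _ _ => rfl, ?_⟩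
    intro U' a' p q hRL' hM hx0 hx10 j'
    refine ⟨n, j' + (j1 - j), ?_, by simp; omega⟩
    have := run_congr (a' := a') (b' := K t) (Bd (kap Z) U' k1 + x) j' h ?_ (fun _ _ => rfl)
    · rw [this]; congr 2; simp only [Prod.mk.injEq, and_true]; omega
    · intro r hr
      have e1 := hRL k1 (x + r) (by omega)
      have e2 := hRL' k1 (x + r) (by
        by_cases hp : k1 = p ∨ k1 = q
        · have := hx10 hp; omega
        · push Not at hp; rw [hM.eq k1 hp.1 hp.2]; omega)
      rw [add_assoc, e1, add_assoc, e2]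
  | succ D ih =>
    intro k k1 n z x j z1 x1 j1 hk h hx hx1
    have hB := Bd_succ (kap Z) U k
    have hB1 := Bd_le (κ := kap Z) (u := U) (show k + 1 ≤ k1 by omega)
    obtain ⟨n0, z0, j0, z', e, hn0, h1, h2, h3⟩ :=
      run_cross (Bd (kap Z) U k + kap Z * U k) h (by omega) (by omega)
    rw [show Bd (kap Z) U k + kap Z * U k + 1 = Bd (kap Z) U (k+1) + 0 by omega] at h3
    obtain ⟨σ, hσ, hσ0, hrest⟩ := ih (by omega) h3 (by omega) hx1
    have hs := hRL k (kap Z * U k) (by omega)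
    rw [hs] at h2
    have hm1 := run_mono h1
    have hmr := run_mono h3
    -- the step and the rest in the variant
    have fin : ∀ U' a' p q, RL (kap Z) a' sy U' → Md U U' p q →
        ((k1 = p ∨ k1 = q) → x1 = 0) → ∀ n1 j' j2,
        run F a' (K t) n1 z (Bd (kap Z) U' k + x) j' =
          some (z0, Bd (kap Z) U' k + kap Z * U' k, j2) → ∃ n' j1',
        run F a' (K t) n' z (Bd (kap Z) U' k + x) j' = some (z1, Bd (kap Z) U' k1 + x1, j1') ∧
        j1' + j0 + σ p = j1 + j2 + σ q := by
      intro U' a' p q hRL' hM hx10 n1 j' j2 hr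
      have hs' := hRL' k (kap Z * U' k) (by omega)
      have hB' := Bd_succ (kap Z) U' k
      obtain ⟨n', j1', hr2, hj⟩ := hrest U' a' p q hRL' hM (fun _ => rfl) hx10 (j2 + e.toNat)
      have hst := run_one F a' (K t) (i := Bd (kap Z) U' k + kap Z * U' k) (j := j2)
        (by rw [hs']; exact h2)
      rw [show Bd (kap Z) U' k + kap Z * U' k + (true).toNat = Bd (kap Z) U' (k+1) + 0 by
        simp; omega] at hst
      exact ⟨_, j1', run_trans hr (run_trans hst hr2), by omega⟩
    have same : ∀ U' a' p q, RL (kap Z) a' sy U' → Md U U' p q →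
        k ≠ p → k ≠ q →
        ((k1 = p ∨ k1 = q) → x1 = 0) → ∀ j', ∃ n' j1',
        run F a' (K t) n' z (Bd (kap Z) U' k + x) j' = some (z1, Bd (kap Z) U' k1 + x1, j1') ∧
        j1' + j + σ p = j1 + j' + σ q := by
      intro U' a' p q hRL' hM hp hq hx10 j'
      have hUe := hM.eq k hp hq
      have := run_congr (a' := a') (b' := K t) (Bd (kap Z) U' k + x) j' h1 ?_ (fun _ _ => rfl)
      · rw [show Bd (kap Z) U' k + x + (Bd (kap Z) U k + kap Z * U k - (Bd (kap Z) U k + x)) =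
          Bd (kap Z) U' k + kap Z * U' k by rw [hUe]; omega] at this
        obtain ⟨n', j1', h5, h6⟩ := fin U' a' p q hRL' hM hx10 _ _ _ this
        exact ⟨n', j1', h5, by omega⟩
      · intro r hr
        have e1 := hRL k (x + r) (by omega)
        have e2 := hRL' k (x + r) (by rw [hUe]; omega)
        rw [add_assoc, e1, add_assoc, e2]
    by_cases hc : x = 0 ∧ U k = 1
    · obtain ⟨rfl, hU1⟩ := hc
      have hconst := run_congr (a' := K (sy k)) (b' := K t) 0 0 h1 (by
        intro r hr
        rw [add_assoc]
        exact hRL k (0 + r) (by omega)) (fun _ _ => rfl)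
      rw [show 0 + (Bd (kap Z) U k + kap Z * U k - (Bd (kap Z) U k + 0)) = kap Z * U k by omega]
        at hconst
      obtain ⟨σk, hb, hdv, hall⟩ := cl_cross hF (by omega) hconst h2
      have mod : ∀ U' a' p q, RL (kap Z) a' sy U' → Md U U' p q →
        ((k1 = p ∨ k1 = q) → x1 = 0) → ∀ j', ∃ n' j1',
        run F a' (K t) n' z (Bd (kap Z) U' k + 0) j' = some (z1, Bd (kap Z) U' k1 + x1, j1') ∧
        j1' + j + σ p + σk = j1 + j' + σ q + U' k * σk := by
        intro U' a' p q hRL' hM hx10 j'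
        obtain ⟨n', Y', h5, h6⟩ := hall (U' k)
        have := run_congr (a' := a') (b' := K t) (Bd (kap Z) U' k + 0) j' h5 (by
          intro r hr
          rw [add_assoc]
          exact (hRL' k (0 + r) (by omega)).symm) (fun _ _ => rfl)
        rw [show Bd (kap Z) U' k + 0 + (kap Z * U' k - 0) = Bd (kap Z) U' k + kap Z * U' k by omega]
          at this
        obtain ⟨n'', j1', h7, h8⟩ := fin U' a' p q hRL' hM hx10 _ _ _ this
        refine ⟨n'', j1', h7, ?_⟩
        rw [hU1] at h6
        omega
      refine ⟨Function.update σ k σk, ?_, ?_, ?_⟩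
      · intro r
        by_cases hr : r = k
        · subst hr; simp [hb, hdv]
        · simp [Function.update_of_ne hr, hσ r]
      · intro r hr
        rw [Function.update_of_ne (by omega)]
        exact hσ0 r (by omega)
      · intro U' a' p q hRL' hM hx0 hx10 j'
        have hk0 := hσ0 k (by omega)
        have hM1 := hM.ne
        by_cases hkp : k = p
        · subst hkp
          obtain ⟨n', j1', h5, h6⟩ := mod U' a' k q hRL' hM hx10 j'
          refine ⟨n', j1', h5, ?_⟩
          rw [Function.update_self, Function.update_of_ne (Ne.symm hM1)]
          rw [hM.up'] at h6
          omega
        · by_cases hkq : k = q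
          · subst hkq
            obtain ⟨n', j1', h5, h6⟩ := mod U' a' p k hRL' hM hx10 j'
            refine ⟨n', j1', h5, ?_⟩
            rw [Function.update_self, Function.update_of_ne hM1]
            rw [hM.uq'] at h6
            omega
          · rw [Function.update_of_ne (Ne.symm hkp), Function.update_of_ne (Ne.symm hkq)]
            exact same U' a' p q hRL' hM hkp hkq hx10 j'
    · refine ⟨σ, hσ, fun r hr => hσ0 r (by omega), ?_⟩
      intro U' a' p q hRL' hM hx0 hx10 j'
      refine same U' a' p q hRL' hM ?_ ?_ hx10 j'
      · rintro rfl; exact hc ⟨hx0 (Or.inl rfl), hM.up⟩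
      · rintro rfl; exact hc ⟨hx0 (Or.inr rfl), hM.uq⟩

end

end WKP

namespace WKP

open Finset

variable {S Z : Type}

/-- corresponding positions -/
def Corr (κ : ℕ) (U U' : ℕ → ℕ) (i i' : ℕ) : Prop :=
  ∃ k x, i = Bd κ U k + x ∧ i' = Bd κ U' k + x ∧ x < 1 + κ * U k ∧ (U' k ≠ U k → x = 0)

theorem Corr.sym {κ : ℕ} {U U' : ℕ → ℕ} {i i' : ℕ} {a a' sy : ℕ → S} (h : Corr κ U U' i i')
    (h1 : RL κ a sy U) (h2 : RL κ a' sy U') : a' i' = a i := by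
  obtain ⟨k, x, rfl, rfl, hx, h3⟩ := h
  rw [h1 k x hx, h2 k x]
  by_cases h4 : U' k = U k
  · rw [h4]; exact hx
  · have := h3 h4; omega

theorem Corr.start {κ : ℕ} {U U' : ℕ → ℕ} (k : ℕ) : Corr κ U U' (Bd κ U k) (Bd κ U' k) :=
  ⟨k, 0, by simp, by simp, by omega, fun _ => rfl⟩

theorem Md.iff {U U' : ℕ → ℕ} {p q : ℕ} (h : Md U U' p q) (k : ℕ) :
    U' k ≠ U k ↔ (k = p ∨ k = q) := by
  constructor
  · intro h1; by_contra h2; push Not at h2; exact h1 (h.eq k h2.1 h2.2)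
  · rintro (rfl | rfl)
    · rw [h.up, h.up']; omega
    · rw [h.uq, h.uq']; omega

/-- the end position is not inside a modified run -/
def EndOK (κ : ℕ) (U : ℕ → ℕ) (p q i : ℕ) : Prop :=
  ∀ k x, i = Bd κ U k + x → x < 1 + κ * U k → (k = p ∨ k = q) → x = 0

theorem toK {F : Mach S Z} {κ : ℕ} {a b sy : ℕ → S} {V : ℕ → ℕ} {n z i z1 i1 k y y1}
    (hb : RL κ b sy V) (h : run F a b n z i (Bd κ V k + y) = some (z1, i1, Bd κ V k + y1))
    (hy : y1 < 1 + κ * V k) : run F a (K (sy k)) n z i y = some (z1, i1, y1) := by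
  have hm := run_mono h
  have := run_congr (a' := a) (b' := K (sy k)) i y h (fun _ _ => rfl) (by
    intro q hq
    rw [add_assoc]; exact hb k (y+q) (by omega))
  rw [this]; simp only [Option.some.injEq, Prod.mk.injEq, true_and]; omega

theorem ofK {F : Mach S Z} {κ : ℕ} {a b sy : ℕ → S} {V : ℕ → ℕ} {n z i z1 i1 k y y1}
    (hb : RL κ b sy V) (h : run F a (K (sy k)) n z i y = some (z1, i1, y1))
    (hy : y1 < 1 + κ * V k) : run F a b n z i (Bd κ V k + y) = some (z1, i1, Bd κ V k + y1) := by
  have hm := run_mono h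
  have := run_congr (a' := a) (b' := b) i (Bd κ V k + y) h (fun _ _ => rfl) (by
    intro q hq
    rw [add_assoc]; exact (hb k (y+q) (by omega)).symm)
  rw [this]; simp only [Option.some.injEq, Prod.mk.injEq, true_and]; omega

theorem run_reach {F : Mach S Z} {a b : ℕ → S} {n z i j z1 i1 j1} (p : ℕ)
    (h : run F a b n z i j = some (z1, i1, j1)) (h1 : i ≤ p) (h2 : p ≤ i1) :
    ∃ n0 n1 z0 j0, run F a b n0 z i j = some (z0, p, j0) ∧
      run F a b n1 z0 p j0 = some (z1, i1, j1) := by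
  rcases Nat.eq_or_lt_of_le h2 with rfl | h3
  · exact ⟨n, 0, z1, j1, h, rfl⟩
  · obtain ⟨n0, z0, j0, z', e, _, h4, h5, h6⟩ := run_cross p h h1 h3
    refine ⟨n0, 1 + (n - n0 - 1), z0, j0, h4, run_trans (run_one F a b h5) ?_⟩
    simpa using h6

section
variable [Fintype Z]

theorem OHC {F : Mach S Z} (hF : Inj F) {t : S} {a : ℕ → S} {sy : ℕ → S} {U : ℕ → ℕ}
    (hRL : RL (kap Z) a sy U) {n z i j z1 i1 j1}
    (h : run F a (K t) n z i j = some (z1, i1, j1)) :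
    ∃ σ : ℕ → ℕ, (∀ r, σ r ≤ kap Z * Fintype.card Z ∧ (Fintype.card Z).factorial ∣ σ r) ∧
      ∀ U' a' p q, RL (kap Z) a' sy U' → Md U U' p q → EndOK (kap Z) U p q i1 →
        ∀ i' j', Corr (kap Z) U U' i i' → ∃ n' i1' j1',
        run F a' (K t) n' z i' j' = some (z1, i1', j1') ∧ Corr (kap Z) U U' i1 i1' ∧
        j1' + j + σ p = j1 + j' + σ q := by
  obtain ⟨k, x, rfl, hx⟩ := Bd_dec (kap Z) U i
  obtain ⟨k1, x1, rfl, hx1⟩ := Bd_dec (kap Z) U i1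
  have hm := run_mono h
  have hk := Bd_idx_le hm.1 hx1
  obtain ⟨σ, hσ, -, hall⟩ := OH hF hRL (k1 - k) (by omega) h hx hx1
  refine ⟨σ, hσ, ?_⟩
  intro U' a' p q hRL' hM hE i' j' hC
  obtain ⟨k2, x2, h1, h2, h3, h4⟩ := hC
  obtain ⟨rfl, rfl⟩ := Bd_uniq h1 hx h3
  have hE1 := hE k1 x1 rfl hx1
  obtain ⟨n', j1', h5, h6⟩ := hall U' a' p q hRL' hM (fun hh => h4 ((hM.iff _).2 hh)) hE1 j'
  exact ⟨n', _, j1', by rw [h2]; exact h5,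
    ⟨k1, x1, rfl, rfl, hx1, fun hh => hE1 ((hM.iff _).1 hh)⟩, h6⟩

theorem WIN {F : Mach S Z} {t : S} {a : ℕ → S} (W : ℕ) : ∀ {n z i j z1 i1 j1},
    run F a (K t) n z i j = some (z1, i1, j1) → i1 ≤ i + W → (W + 1) * Fintype.card Z ≤ n →
    ∃ n1 zz i2 j2 T d, n1 ≤ n ∧ n1 ≤ (W + 1) * Fintype.card Z ∧
      run F a (K t) n1 z i j = some (zz, i2, j2) ∧ 1 ≤ T ∧ d ≤ Fintype.card Z ∧
      ∀ i j, run F (K (a i2)) (K t) T zz i j = some (zz, i, j + d) := by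
  induction W with
  | zero =>
    intro n z i j z1 i1 j1 h hi hn
    obtain ⟨n1, T, zz, i2, j2, i3, j3, h1, h2, h3, h4⟩ := run_pigeon (by omega) h
    have h5 := run_rest (by omega) h (run_trans h3 h4)
    have e1 := run_mono h3
    have e2 := run_mono h4
    have e3 := run_mono h5
    obtain rfl : i2 = i := by omega
    obtain rfl : i3 = i2 := by omega
    refine ⟨n1, zz, i3, j2, T, j3 - j2, by omega, by omega, h3, h1, by omega, ?_⟩
    intro i j
    have := run_congr (a' := K (a i3)) (b' := K t) i j h4 (by
      intro q hq
      obtain rfl : q = 0 := by omega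
      rfl) (fun _ _ => rfl)
    simpa using this
  | succ W ih =>
    intro n z i j z1 i1 j1 h hi hn
    rw [add_mul (W+1), one_mul] at hn
    obtain ⟨z', i', j', h1, h2⟩ := run_upto (k := Fintype.card Z) (by omega) h
    have e1 := run_mono h1
    by_cases hi' : i' = i
    · subst hi'
      obtain ⟨n1, T, zz, i2, j2, i3, j3, hT, h2, h3, h4⟩ := run_pigeon (le_refl _) h1
      have h5 := run_rest (by omega) h1 (run_trans h3 h4)
      have e1 := run_mono h3
      have e2 := run_mono h4
      have e3 := run_mono h5
      obtain rfl : i2 = i' := by omega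
      obtain rfl : i3 = i2 := by omega
      refine ⟨n1, zz, i3, j2, T, j3 - j2, by omega, by rw [add_mul (W+1)]; omega, h3, hT,
        by omega, ?_⟩
      intro i j
      have := run_congr (a' := K (a i3)) (b' := K t) i j h4 (by
        intro q hq
        obtain rfl : q = 0 := by omega
        rfl) (fun _ _ => rfl)
      simpa using this
    · obtain ⟨n1, zz, i2, j2, T, d, h3, h4, h5, h6⟩ := ih h2 (by omega) (by omega)
      exact ⟨Fintype.card Z + n1, zz, i2, j2, T, d, by omega, by rw [add_mul (W+1)]; omega,
        run_trans h1 h5, h6⟩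

theorem adj {F : Mach S Z} {s t : S} {T zz d r z1 Y z2 f} (hT : 1 ≤ T)
    (hd : d ≤ Fintype.card Z)
    (hloop : ∀ i j, run F (K s) (K t) T zz i j = some (zz, i, j + d))
    (hr : run F (K s) (K t) r zz 0 0 = some (z1, 0, Y))
    (hnext : F s t z1 = some (z2, f, true)) (δ : ℕ) (hδ : (Fintype.card Z).factorial ∣ δ) :
    (∃ r', run F (K s) (K t) r' zz 0 0 = some (z1, 0, Y + δ)) ∧
    (δ ≤ Y → ∃ r', run F (K s) (K t) r' zz 0 0 = some (z1, 0, Y - δ)) := by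
  have hl : ∀ j i, run (swF F) (K t) (K s) T zz j i = some (zz, j + d, i + 0) := by
    intro j i; rw [run_sw]; exact hloop i j
  have hr' := (run_sw F (K s) (K t)).2 hr
  have hn' := (swF_some F).2 hnext
  have hd0 : 0 < d := by
    rcases Nat.eq_zero_or_pos d with rfl | hd
    · obtain ⟨z3, j3, h6, z4, e4, h7⟩ := loop_run (d := 0) hT (by simpa using hl) r 0 0
      rw [hr'] at h6
      simp only [Option.some.injEq, Prod.mk.injEq] at h6
      obtain ⟨rfl, _, _⟩ := h6
      rw [hn'] at h7
      simp at h7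
    · exact hd
  obtain ⟨q, rfl⟩ := (Nat.dvd_factorial hd0 hd).trans hδ
  constructor
  · have := cl_add hl hr' q
    rw [run_sw] at this
    refine ⟨_, by rw [this]; congr 3; ring⟩
  · intro hq
    have := (cl_sub hl hr' hn' q (by rw [mul_comm]; exact hq)).2
    rw [run_sw] at this
    refine ⟨_, by rw [this]; congr 3; ring_nf⟩

theorem depth0 {F : Mach S Z} (hF : Inj F) {t : S} {a sy : ℕ → S} {U : ℕ → ℕ} {κ : ℕ}
    (hRL : RL κ a sy U) {n z i j zz j2 T d k x}
    (h : run F a (K t) n z i j = some (zz, Bd κ U k + x, j2)) (hx : x < 1 + κ * U k)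
    (hi : i ≤ Bd κ U k) (hT : 1 ≤ T)
    (hloop : ∀ i j, run F (K (sy k)) (K t) T zz i j = some (zz, i, j + d)) : x = 0 := by
  obtain ⟨n0, n1, z0, j0, h1, h2⟩ := run_reach (Bd κ U k) h hi (by omega)
  have := run_congr (a' := K (sy k)) (b' := K t) 0 0 h2 (by
    intro q hq; exact hRL k q (by omega)) (fun _ _ => rfl)
  have := back_inj hF this hT hloop
  omega

/-- exit from a fresh long run, in the world where head 2 reads a constant -/
theorem lemB {F : Mach S Z} (hF : Inj F) {t : S} {a sy : ℕ → S} {U : ℕ → ℕ}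
    (hRL : RL (kap Z) a sy U) {W n z i z1 i1 L z2 f}
    (h : run F a (K t) n z i 0 = some (z1, i1, L)) (hnext : F (a i1) t z1 = some (z2, f, true))
    (hW : i1 ≤ i + W)
    (hL : (W + 1) * Fintype.card Z + kap Z * Fintype.card Z ≤ L) :
    f = false ∧ ∀ U' a' p q, RL (kap Z) a' sy U' → Md U U' p q →
      ∀ i', Corr (kap Z) U U' i i' → ∃ n' i1',
        run F a' (K t) n' z i' 0 = some (z1, i1', L) ∧ Corr (kap Z) U U' i1 i1' := by
  have hm := run_mono h
  obtain ⟨n1, zz, i2, j2, T, d, h1, h2, h3, hT, hd, hloop⟩ := WIN W h hW (by omega)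
  have h4 := run_rest h1 h h3
  obtain ⟨z', j', h5, z'', e, h6⟩ := loop_run hT hloop (n - n1) i2 j2
  have h7 := run_congr (a' := a) (b' := K t) i2 j2 h5 (by
    intro q hq
    obtain rfl : q = 0 := by omega
    rfl) (fun _ _ => rfl)
  have e5 := run_mono h5
  rw [h4] at h7
  simp only [Option.some.injEq, Prod.mk.injEq, Nat.sub_self, add_zero] at h7
  obtain ⟨rfl, rfl, h9⟩ := h7
  have hL2 : L = j' := by omega
  subst hL2
  rw [hnext] at h6
  simp only [Option.some.injEq, Prod.mk.injEq] at h6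
  refine ⟨h6.2.1, ?_⟩
  intro U' a' p q hRL' hM i' hC
  obtain ⟨σ, hσ, hall⟩ := OHC hF hRL h3
  have hE : EndOK (kap Z) U p q i1 := by
    intro k x hk hx hpq
    subst hk
    obtain ⟨k0, x0, rfl, -, hx0, hc0⟩ := hC
    have hk0 := Bd_idx_le hm.1 hx
    refine depth0 hF hRL h3 hx ?_ hT (by rw [← hRL k x hx]; exact hloop)
    rcases Nat.eq_or_lt_of_le hk0 with rfl | hlt
    · rw [hc0 ((hM.iff _).2 hpq)]; simp
    · have := Bd_le (κ := kap Z) (u := U) (Nat.succ_le_of_lt hlt)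
      rw [Nat.succ_eq_add_one, Bd_succ] at this
      omega
  obtain ⟨n2, i1', j1', h10, h11, h12⟩ := hall U' a' p q hRL' hM hE i' 0 hC
  have hs := h11.sym hRL hRL'
  have hcr := run_const_shift 0 0 h5
  simp only [Nat.sub_self, add_zero, zero_add] at hcr
  have e3 := run_mono h3
  have hp := hσ p
  have hq := hσ q
  have fin : ∀ Y' r', run F (K (a i1)) (K t) r' zz 0 0 = some (z1, 0, Y') → j1' + Y' = L →
      ∃ n' i1', run F a' (K t) n' z i' 0 = some (z1, i1', L) ∧ Corr (kap Z) U U' i1 i1' := by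
    intro Y' r' h13 h14
    have := run_congr (a' := a') (b' := K t) i1' j1' h13 (by
      intro q hq
      obtain rfl : q = 0 := by omega
      exact hs.symm) (fun _ _ => rfl)
    refine ⟨_, i1', (run_trans h10 this).trans ?_, h11⟩
    simp only [Nat.sub_self, add_zero, Nat.sub_zero, h14]
  rcases le_total (σ p) (σ q) with hle | hle
  · obtain ⟨r', h13⟩ := (adj hT hd hloop hcr hnext (σ q - σ p) (Nat.dvd_sub hq.2 hp.2)).2 (by omega)
    exact fin _ r' h13 (by omega)
  · obtain ⟨r', h13⟩ := (adj hT hd hloop hcr hnext (σ p - σ q) (Nat.dvd_sub hp.2 hq.2)).1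
    exact fin _ r' h13 (by omega)

/-- halting in a fresh long run, in the world where head 2 reads a constant -/
theorem lemC {F : Mach S Z} (hF : Inj F) {t : S} {a sy : ℕ → S} {U : ℕ → ℕ}
    (hRL : RL (kap Z) a sy U) {W n z i z1 i1 y}
    (h : run F a (K t) n z i 0 = some (z1, i1, y)) (hnext : F (a i1) t z1 = none)
    (hW : i1 ≤ i + W) :
    ∀ U' a' p q, RL (kap Z) a' sy U' → Md U U' p q → EndOK (kap Z) U p q i1 →
      ∀ i', Corr (kap Z) U U' i i' → ∃ n' i1' y',
        run F a' (K t) n' z i' 0 = some (z1, i1', y') ∧ Corr (kap Z) U U' i1 i1' ∧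
        y' ≤ (W + 1) * Fintype.card Z + kap Z * Fintype.card Z := by
  have hm := run_mono h
  have hn : n ≤ (W + 1) * Fintype.card Z := by
    by_contra hlt
    push Not at hlt
    obtain ⟨n1, zz, i2, j2, T, d, h1, h2, h3, hT, hd, hloop⟩ := WIN W h hW (by omega)
    have h4 := run_rest h1 h h3
    obtain ⟨z', j', h5, z'', e, h6⟩ := loop_run hT hloop (n - n1) i2 j2
    have h7 := run_congr (a' := a) (b' := K t) i2 j2 h5 (by
      intro q hq
      obtain rfl : q = 0 := by omega
      rfl) (fun _ _ => rfl)
    rw [h4] at h7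
    simp only [Option.some.injEq, Prod.mk.injEq, Nat.sub_self, add_zero] at h7
    obtain ⟨rfl, rfl, h9⟩ := h7
    rw [hnext] at h6
    simp at h6
  intro U' a' p q hRL' hM hE i' hC
  obtain ⟨σ, hσ, hall⟩ := OHC hF hRL h
  obtain ⟨n2, i1', j1', h10, h11, h12⟩ := hall U' a' p q hRL' hM hE i' 0 hC
  have hq := hσ q
  exact ⟨n2, i1', j1', h10, h11, by omega⟩

end

end WKP

namespace WKP

open Finset

variable {S Z : Type} [Fintype Z]

structure Base (S Z : Type) [Fintype Z] where
  F : Mach S Z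
  acc : Z → Prop
  hF : Inj F
  sy1 : ℕ → S
  sy2 : ℕ → S
  U1 : ℕ → ℕ
  U2 : ℕ → ℕ
  a : ℕ → S
  b : ℕ → S
  r1 : RL (kap Z) a sy1 U1
  r2 : RL (kap Z) b sy2 U2
  Feat : ℕ → Prop
  f1 : ℕ → ℕ
  f2 : ℕ → ℕ
  i1 : ∀ p q, Feat p → Feat q → f1 p = f1 q → p = q
  i2 : ∀ p q, Feat p → Feat q → f2 p = f2 q → p = q

def Base.sw (B : Base S Z) : Base S Z where
  F := swF B.F
  acc := B.acc
  hF := B.hF.sw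
  sy1 := B.sy2
  sy2 := B.sy1
  U1 := B.U2
  U2 := B.U1
  a := B.b
  b := B.a
  r1 := B.r2
  r2 := B.r1
  Feat := B.Feat
  f1 := B.f2
  f2 := B.f1
  i1 := B.i2
  i2 := B.i1

/-- a variant of the base word: feature `p` shortened, feature `q` lengthened -/
structure Vr (B : Base S Z) (p q : ℕ) (U1 U2 : ℕ → ℕ) (a b : ℕ → S) : Prop where
  fp : B.Feat p
  fq : B.Feat q
  m1 : Md B.U1 U1 (B.f1 p) (B.f1 q)
  m2 : Md B.U2 U2 (B.f2 p) (B.f2 q)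
  r1 : RL (kap Z) a B.sy1 U1
  r2 : RL (kap Z) b B.sy2 U2

theorem Vr.sw {B : Base S Z} {p q : ℕ} {U1 U2 : ℕ → ℕ} {a b : ℕ → S}
    (h : Vr B.sw p q U2 U1 b a) : Vr B p q U1 U2 a b :=
  ⟨h.fp, h.fq, h.m2, h.m1, h.r2, h.r1⟩

theorem Vr.sw' {B : Base S Z} {p q : ℕ} {U1 U2 : ℕ → ℕ} {a b : ℕ → S}
    (h : Vr B p q U1 U2 a b) : Vr B.sw p q U2 U1 b a :=
  ⟨h.fp, h.fq, h.m2, h.m1, h.r2, h.r1⟩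

def AccF (F : Mach S Z) (acc : Z → Prop) (a b : ℕ → S) (z : Z) (i j : ℕ) : Prop :=
  ∃ n z1 i1 j1, run F a b n z i j = some (z1, i1, j1) ∧ F (a i1) (b j1) z1 = none ∧ acc z1

abbrev C1 (B : Base S Z) (U : ℕ → ℕ) (i i' : ℕ) : Prop := Corr (kap Z) B.U1 U i i'
abbrev C2 (B : Base S Z) (U : ℕ → ℕ) (i i' : ℕ) : Prop := Corr (kap Z) B.U2 U i i'

def TrL (B : Base S Z) (L : List (ℕ → ℕ)) (X : List ℕ) (z : Z) (i j : ℕ) (z1 : Z) (i1 j1 : ℕ) :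
    Prop :=
  ∀ p q U1 U2 a b, Vr B p q U1 U2 a b → p ∉ X → q ∉ X → (∀ σ ∈ L, σ p = σ q) →
    ∀ i' j', C1 B U1 i i' → C2 B U2 j j' → ∃ n i1' j1',
      run B.F a b n z i' j' = some (z1, i1', j1') ∧ C1 B U1 i1 i1' ∧ C2 B U2 j1 j1'

def GoodL (B : Base S Z) (L : List (ℕ → ℕ)) (X : List ℕ) (z : Z) (i j : ℕ) : Prop :=
  ∀ p q U1 U2 a b, Vr B p q U1 U2 a b → p ∉ X → q ∉ X → (∀ σ ∈ L, σ p = σ q) →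
    ∀ i' j', C1 B U1 i i' → C2 B U2 j j' → AccF B.F B.acc a b z i' j'

def Lb (Z : Type) [Fintype Z] (L : List (ℕ → ℕ)) : Prop :=
  ∀ σ ∈ L, ∀ r, σ r ≤ kap Z * Fintype.card Z

def Tr (B : Base S Z) (c p : ℕ) (z : Z) (i j : ℕ) (z1 : Z) (i1 j1 : ℕ) : Prop :=
  ∃ L X, L.length ≤ c ∧ X.length ≤ p ∧ Lb Z L ∧ TrL B L X z i j z1 i1 j1

def Good (B : Base S Z) (c p : ℕ) (z : Z) (i j : ℕ) : Prop :=
  ∃ L X, L.length ≤ c ∧ X.length ≤ p ∧ Lb Z L ∧ GoodL B L X z i j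

theorem Good.mono {B : Base S Z} {c p c' p' : ℕ} {z i j} (h : Good B c p z i j) (hc : c ≤ c')
    (hp : p ≤ p') : Good B c' p' z i j := by
  obtain ⟨L, X, h1, h2, h3, h4⟩ := h
  exact ⟨L, X, by omega, by omega, h3, h4⟩

theorem Tr.trans {B : Base S Z} {c p c' p' : ℕ} {z i j z1 i1 j1 z2 i2 j2}
    (h : Tr B c p z i j z1 i1 j1) (h' : Tr B c' p' z1 i1 j1 z2 i2 j2) :
    Tr B (c + c') (p + p') z i j z2 i2 j2 := by
  obtain ⟨L, X, h1, h2, h3, h4⟩ := h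
  obtain ⟨L', X', h1', h2', h3', h4'⟩ := h'
  refine ⟨L ++ L', X ++ X', by simp; omega, by simp; omega, ?_, ?_⟩
  · intro σ hσ
    rcases List.mem_append.1 hσ with h | h
    · exact h3 σ h
    · exact h3' σ h
  · intro p q U1 U2 a b hV hp hq hσ i' j' hi hj
    simp only [List.mem_append, not_or] at hp hq
    obtain ⟨n, x, y, e1, e2, e3⟩ := h4 p q U1 U2 a b hV hp.1 hq.1
      (fun σ h => hσ σ (List.mem_append_left _ h)) i' j' hi hj
    obtain ⟨n', x', y', e4, e5, e6⟩ := h4' p q U1 U2 a b hV hp.2 hq.2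
      (fun σ h => hσ σ (List.mem_append_right _ h)) x y e2 e3
    exact ⟨_, x', y', run_trans e1 e4, e5, e6⟩

theorem Tr.good {B : Base S Z} {c p c' p' : ℕ} {z i j z1 i1 j1}
    (h : Tr B c p z i j z1 i1 j1) (h' : Good B c' p' z1 i1 j1) :
    Good B (c + c') (p + p') z i j := by
  obtain ⟨L, X, h1, h2, h3, h4⟩ := h
  obtain ⟨L', X', h1', h2', h3', h4'⟩ := h'
  refine ⟨L ++ L', X ++ X', by simp; omega, by simp; omega, ?_, ?_⟩
  · intro σ hσ
    rcases List.mem_append.1 hσ with h | h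
    · exact h3 σ h
    · exact h3' σ h
  · intro p q U1 U2 a b hV hp hq hσ i' j' hi hj
    simp only [List.mem_append, not_or] at hp hq
    obtain ⟨n, x, y, e1, e2, e3⟩ := h4 p q U1 U2 a b hV hp.1 hq.1
      (fun σ h => hσ σ (List.mem_append_left _ h)) i' j' hi hj
    obtain ⟨n', z', x', y', e4, e5, e6⟩ := h4' p q U1 U2 a b hV hp.2 hq.2
      (fun σ h => hσ σ (List.mem_append_right _ h)) x y e2 e3
    exact ⟨_, z', x', y', run_trans e1 e4, e5, e6⟩

theorem good_halt {B : Base S Z} {z i j} (h : B.F (B.a i) (B.b j) z = none) (ha : B.acc z) :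
    Good B 0 0 z i j := by
  refine ⟨[], [], by simp, by simp, by intro σ h; simp at h, ?_⟩
  intro p q U1 U2 a b hV hp hq hσ i' j' hi hj
  refine ⟨0, z, i', j', rfl, ?_, ha⟩
  rw [hi.sym B.r1 hV.r1, hj.sym B.r2 hV.r2]; exact h

theorem Tr.sw {B : Base S Z} {c p : ℕ} {z i j z1 i1 j1}
    (h : Tr B.sw c p z j i z1 j1 i1) : Tr B c p z i j z1 i1 j1 := by
  obtain ⟨L, X, h1, h2, h3, h4⟩ := h
  refine ⟨L, X, h1, h2, h3, ?_⟩
  intro p q U1 U2 a b hV hp hq hσ i' j' hi hj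
  obtain ⟨n, x, y, e1, e2, e3⟩ := h4 p q U2 U1 b a hV.sw' hp hq hσ j' i' hj hi
  exact ⟨n, y, x, (run_sw B.F a b).1 e1, e3, e2⟩

theorem Good.sw {B : Base S Z} {c p : ℕ} {z i j}
    (h : Good B.sw c p z j i) : Good B c p z i j := by
  obtain ⟨L, X, h1, h2, h3, h4⟩ := h
  refine ⟨L, X, h1, h2, h3, ?_⟩
  intro p q U1 U2 a b hV hp hq hσ i' j' hi hj
  obtain ⟨n, z', x, y, e1, e2, e3⟩ := h4 p q U2 U1 b a hV.sw' hp hq hσ j' i' hj hi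
  exact ⟨n, z', y, x, (run_sw B.F a b).1 e1, (swF_none B.F).1 e2, e3⟩

/-- no unexcluded feature at position `i` of tape 1 -/
def Ex1 (B : Base S Z) (X : List ℕ) (i : ℕ) : Prop :=
  ∀ p, B.Feat p → p ∉ X → ∀ k x, i = Bd (kap Z) B.U1 k + x → x < 1 + kap Z * B.U1 k → k ≠ B.f1 p

theorem Ex1.mono {B : Base S Z} {X Y : List ℕ} {i : ℕ} (h : Ex1 B X i) (hs : X ⊆ Y) : Ex1 B Y i :=
  fun p hp hx => h p hp fun h' => hx (hs h')

theorem ex1 (B : Base S Z) (i : ℕ) : ∃ X : List ℕ, X.length ≤ 1 ∧ Ex1 B X i := by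
  obtain ⟨k, x, h1, h2⟩ := Bd_dec (kap Z) B.U1 i
  by_cases h : ∃ p, B.Feat p ∧ k = B.f1 p
  · obtain ⟨p, hp, hk⟩ := h
    refine ⟨[p], by simp, ?_⟩
    intro q hq hx k2 x2 h3 h4 h5
    obtain ⟨rfl, rfl⟩ := Bd_uniq (h3.symm.trans h1) h4 h2
    have := B.i1 p q hp hq (by rw [← hk, ← h5])
    subst this
    simp at hx
  · refine ⟨[], by simp, ?_⟩
    intro q hq hx k2 x2 h3 h4 h5
    obtain ⟨rfl, rfl⟩ := Bd_uniq (h3.symm.trans h1) h4 h2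
    exact h ⟨q, hq, h5⟩

theorem Ex1.endOK {B : Base S Z} {X : List ℕ} {i p q : ℕ} (h : Ex1 B X i) (hp : B.Feat p)
    (hq : B.Feat q) (hp' : p ∉ X) (hq' : q ∉ X) : EndOK (kap Z) B.U1 (B.f1 p) (B.f1 q) i := by
  intro k x h1 h2 h3
  rcases h3 with h3 | h3
  · exact absurd h3 (h p hp hp' k x h1 h2)
  · exact absurd h3 (h q hq hq' k x h1 h2)

theorem Ex1.unmod {B : Base S Z} {X : List ℕ} {i p q : ℕ} {U1 U2 a b} (h : Ex1 B X i)
    (hV : Vr B p q U1 U2 a b) (hp' : p ∉ X) (hq' : q ∉ X) {k x : ℕ}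
    (h1 : i = Bd (kap Z) B.U1 k + x) (h2 : x < 1 + kap Z * B.U1 k) : U1 k = B.U1 k :=
  hV.m1.eq k (h p hV.fp hp' k x h1 h2) (h q hV.fq hq' k x h1 h2)

theorem Ex1.move {B : Base S Z} {X : List ℕ} {i i' p q : ℕ} {U1 U2 a b} (h : Ex1 B X i)
    (hV : Vr B p q U1 U2 a b) (hp' : p ∉ X) (hq' : q ∉ X) (hC : C1 B U1 i i') :
    C1 B U1 (i+1) (i'+1) := by
  obtain ⟨k, x, h1, h2, h3, h4⟩ := hC
  have hu := h.unmod hV hp' hq' h1 h3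
  by_cases hx : x + 1 < 1 + kap Z * B.U1 k
  · exact ⟨k, x+1, by omega, by omega, hx, fun h => absurd hu h⟩
  · refine ⟨k+1, 0, ?_, ?_, by omega, fun _ => rfl⟩
    · rw [Bd_succ]; omega
    · rw [Bd_succ, hu]; omega

theorem tr_step {B : Base S Z} {X : List ℕ} {z i j z' d e}
    (h : B.F (B.a i) (B.b j) z = some (z', d, e)) (h1 : d = true → Ex1 B X i)
    (h2 : e = true → Ex1 B.sw X j) : Tr B 0 X.length z i j z' (i + d.toNat) (j + e.toNat) := by
  refine ⟨[], X, by simp, le_refl _, by intro σ h; simp at h, ?_⟩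
  intro p q U1 U2 a b hV hp hq hσ i' j' hi hj
  refine ⟨1, i' + d.toNat, j' + e.toNat, run_one B.F a b ?_, ?_, ?_⟩
  · rw [hi.sym B.r1 hV.r1, hj.sym B.r2 hV.r2]; exact h
  · cases d
    · simpa using hi
    · exact (h1 rfl).move hV hp hq hi
  · cases e
    · simpa using hj
    · exact (h2 rfl).move hV.sw' hp hq hj

/-- balanced phase -/
theorem trA {B : Base S Z} {X : List ℕ} {n z i kb y z1 i1 y1}
    (h : run B.F B.a B.b n z i (Bd (kap Z) B.U2 kb + y) =
      some (z1, i1, Bd (kap Z) B.U2 kb + y1)) (hy : y1 < 1 + kap Z * B.U2 kb)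
    (h1 : Ex1 B X i1) (h2 : Ex1 B.sw X (Bd (kap Z) B.U2 kb + y)) :
    Tr B 1 X.length z i (Bd (kap Z) B.U2 kb + y) z1 i1 (Bd (kap Z) B.U2 kb + y1) := by
  have hm := run_mono h
  obtain ⟨σ, hσ, hall⟩ := OHC B.hF B.r1 (toK B.r2 h hy)
  refine ⟨[fun r => σ (B.f1 r)], X, by simp, le_refl _, ?_, ?_⟩
  · intro s hs r; simp at hs; subst hs; exact (hσ _).1
  intro p q U1 U2 a b hV hp hq hs i' j' hi hj
  have hs' : σ (B.f1 p) = σ (B.f1 q) := hs (fun r => σ (B.f1 r)) (by simp)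
  have hu : U2 kb = B.U2 kb := h2.unmod hV.sw' hp hq rfl (show _ < 1 + kap Z * B.U2 kb by omega)
  obtain ⟨k, x, e1, rfl, e3, e4⟩ := hj
  obtain ⟨rfl, rfl⟩ := Bd_uniq e1 (by omega) e3
  obtain ⟨n', i1', y1', e5, e6, e7⟩ :=
    hall U1 a (B.f1 p) (B.f1 q) hV.r1 hV.m1 (h1.endOK hV.fp hV.fq hp hq) i' y hi
  obtain rfl : y1' = y1 := by omega
  exact ⟨n', i1', _, ofK hV.r2 e5 (by rw [hu]; exact hy), e6, kb, y1', rfl, rfl, hy,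
    fun h => absurd hu h⟩

/-- head 2 reads a constant symbol forever -/
theorem goodInf {B : Base S Z} {X : List ℕ} {n z i j z1 i1 j1 kb}
    (hc : ∀ k, kb ≤ k → B.sy2 k = B.sy2 kb)
    (h : run B.F B.a B.b n z i j = some (z1, i1, j1)) (hj : Bd (kap Z) B.U2 kb ≤ j)
    (hh : B.F (B.a i1) (B.b j1) z1 = none) (ha : B.acc z1) (h1 : Ex1 B X i1) :
    Good B 0 X.length z i j := by
  have hm := run_mono h
  have hcon : ∀ (b : ℕ → S) (U2 : ℕ → ℕ), RL (kap Z) b B.sy2 U2 →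
      ∀ j, Bd (kap Z) U2 kb ≤ j → b j = B.sy2 kb := by
    intro b U2 hr j hj
    obtain ⟨k, x, rfl, hx⟩ := Bd_dec (kap Z) U2 j
    rw [hr k x hx]
    exact hc k (Bd_idx_le (x := 0) (by simpa using hj) hx)
  have hk := run_congr (a' := B.a) (b' := K (B.sy2 kb)) i j h (fun _ _ => rfl)
    (fun q hq => hcon _ _ B.r2 _ (by omega))
  rw [show i + (i1 - i) = i1 by omega] at hk
  obtain ⟨σ, hσ, hall⟩ := OHC B.hF B.r1 hk
  refine ⟨[], X, by simp, le_refl _, by intro σ h; simp at h, ?_⟩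
  intro p q U1 U2 a b hV hp hq hs i' j' hi hj'
  obtain ⟨k, x, rfl, rfl, e3, e4⟩ := hj'
  have hkk : kb ≤ k := Bd_idx_le (x := 0) (by simpa using hj) e3
  have hle := Bd_le (κ := kap Z) (u := U2) hkk
  obtain ⟨n', i1', y1', e5, e6, e7⟩ :=
    hall U1 a (B.f1 p) (B.f1 q) hV.r1 hV.m1 (h1.endOK hV.fp hV.fq hp hq) i' (Bd (kap Z) U2 k + x) hi
  have hm' := run_mono e5
  have hk := run_congr (a' := a) (b' := b) i' (Bd (kap Z) U2 k + x) e5 (fun _ _ => rfl)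
    (fun q hq => (hcon _ _ hV.r2 _ (by omega)).symm)
  refine ⟨n', z1, _, _, hk, ?_, ha⟩
  rw [show i' + (i1' - i') = i1' by omega, e6.sym B.r1 hV.r1, hcon _ _ hV.r2 _ (by omega),
    ← hcon _ _ B.r2 j1 (by omega)]
  exact hh

/-- fresh exit -/
theorem trB {B : Base S Z} {W n z i kb z1 i1 z2 f}
    (h : run B.F B.a B.b n z i (Bd (kap Z) B.U2 kb) =
      some (z1, i1, Bd (kap Z) B.U2 kb + kap Z * B.U2 kb))
    (hn : B.F (B.a i1) (B.sy2 kb) z1 = some (z2, f, true)) (hW : i1 ≤ i + W)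
    (hL : (W + 1) * Fintype.card Z + kap Z * Fintype.card Z ≤ kap Z * B.U2 kb)
    (h2 : Ex1 B.sw [] (Bd (kap Z) B.U2 kb)) :
    f = false ∧ Tr B 0 0 z i (Bd (kap Z) B.U2 kb) z2 i1 (Bd (kap Z) B.U2 (kb+1)) := by
  have h' := toK (y := 0) B.r2 (by simpa using h) (by omega)
  obtain ⟨rfl, hall⟩ := lemB B.hF B.r1 h' hn hW hL
  refine ⟨rfl, [], [], by simp, by simp, by intro σ h; simp at h, ?_⟩
  intro p q U1 U2 a b hV hp hq hs i' j' hi hj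
  have hu : U2 kb = B.U2 kb :=
    h2.unmod hV.sw' hp hq rfl (show 0 < 1 + kap Z * B.U2 kb by omega)
  obtain ⟨k, x, e1, rfl, e3, e4⟩ := hj
  obtain ⟨rfl, rfl⟩ := Bd_uniq (x := 0) (by simpa using e1) (by omega) e3
  obtain ⟨n', i1', e5, e6⟩ := hall U1 a _ _ hV.r1 hV.m1 i' hi
  have e7 := ofK hV.r2 e5 (by rw [hu]; omega)
  refine ⟨n' + 1, i1', Bd (kap Z) U2 (kb+1), ?_, e6, Corr.start _⟩
  have := run_one B.F a b (i := i1') (j := Bd (kap Z) U2 kb + kap Z * B.U2 kb)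
    (by rw [e6.sym B.r1 hV.r1, hV.r2 kb _ (by rw [hu]; omega)]; exact hn)
  rw [run_trans e7 this, Bd_succ, hu]
  simp; omega

/-- halting in fresh run -/
theorem goodC {B : Base S Z} {X : List ℕ} {W n z i kb z1 i1 y}
    (h : run B.F B.a B.b n z i (Bd (kap Z) B.U2 kb) = some (z1, i1, Bd (kap Z) B.U2 kb + y))
    (hy : y < 1 + kap Z * B.U2 kb)
    (hn : B.F (B.a i1) (B.sy2 kb) z1 = none) (ha : B.acc z1) (hW : i1 ≤ i + W)
    (hL : (W + 1) * Fintype.card Z + kap Z * Fintype.card Z ≤ kap Z * B.U2 kb)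
    (h1 : Ex1 B X i1)
    (h2 : Ex1 B.sw [] (Bd (kap Z) B.U2 kb)) :
    Good B 0 X.length z i (Bd (kap Z) B.U2 kb) := by
  have h' := toK (y := 0) B.r2 (by simpa using h) hy
  have hall := lemC B.hF B.r1 h' hn hW
  refine ⟨[], X, by simp, le_refl _, by intro σ h; simp at h, ?_⟩
  intro p q U1 U2 a b hV hp hq hs i' j' hi hj
  have hu : U2 kb = B.U2 kb :=
    h2.unmod hV.sw' (by simp) (by simp) rfl (show 0 < 1 + kap Z * B.U2 kb by omega)
  obtain ⟨k, x, e1, rfl, e3, e4⟩ := hj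
  obtain ⟨rfl, rfl⟩ := Bd_uniq (x := 0) (by simpa using e1) (by omega) e3
  obtain ⟨n', i1', y', e5, e6, e7⟩ :=
    hall U1 a _ _ hV.r1 hV.m1 (h1.endOK hV.fp hV.fq hp hq) i' hi
  have e8 := ofK hV.r2 e5 (by rw [hu]; omega)
  refine ⟨n', z1, i1', _, e8, ?_, ha⟩
  rw [e6.sym B.r1 hV.r1, hV.r2 kb _ (by rw [hu]; omega)]; exact hn

/-- last configuration inside a region -/
theorem phase {F : Mach S Z} {a b : ℕ → S} (P : ℕ → ℕ → Prop) {n z i j z1 i1 j1}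
    (h : run F a b n z i j = some (z1, i1, j1)) (hP : P i j) :
    P i1 j1 ∨ ∃ n1 n2 z2 i2 j2 z3 d e, run F a b n1 z i j = some (z2, i2, j2) ∧ P i2 j2 ∧
      F (a i2) (b j2) z2 = some (z3, d, e) ∧ ¬ P (i2 + d.toNat) (j2 + e.toNat) ∧
      run F a b n2 z3 (i2 + d.toNat) (j2 + e.toNat) = some (z1, i1, j1) ∧ n1 + 1 + n2 = n := by
  induction n generalizing z i j with
  | zero => simp at h; obtain ⟨rfl, rfl, rfl⟩ := h; exact Or.inl hP
  | succ n ih =>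
    obtain ⟨z', d, e, h1, h2⟩ := (run_succ ..).1 h
    by_cases hP' : P (i + d.toNat) (j + e.toNat)
    · rcases ih h2 hP' with h3 | ⟨n1, n2, z2, i2, j2, z3, d', e', h3, h4, h5, h6, h7, h8⟩
      · exact Or.inl h3
      · exact Or.inr ⟨n1 + 1, n2, z2, i2, j2, z3, d', e', (run_succ ..).2 ⟨z', d, e, h1, h3⟩,
          h4, h5, h6, h7, by omega⟩
    · exact Or.inr ⟨0, n, z, i, j, z', d, e, rfl, hP, h1, hP', h2, by omega⟩

end WKP

namespace WKP

open Finset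

variable {S Z : Type} [Fintype Z]

structure Setup (B : Base S Z) (m R v W : ℕ) : Prop where
  m1 : 1 ≤ m
  u1H : ∀ k, m < k → k ≤ m + R → B.U1 k = v
  u2H : ∀ k, 1 ≤ k → k ≤ R → B.U2 k = v
  u20 : B.U2 0 = 0
  feat1 : ∀ p, B.Feat p → B.f1 p < m
  feat2 : ∀ p, B.Feat p → R + 1 < B.f2 p ∧ B.f2 p < m + R
  c1 : ∀ k, m + R + 1 ≤ k → B.sy1 k = B.sy1 (m + R + 1)
  c2 : ∀ k, m + R + 1 ≤ k → B.sy2 k = B.sy2 (m + R + 1)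
  par : ∀ k l, 1 ≤ k → k ≤ m + R → 1 ≤ l → l ≤ m + R → k % 2 = l % 2 → B.sy2 k = B.sy2 l
  hend : ∀ s z z' d e, B.F s (B.sy2 (m + R + 1)) z = some (z', d, e) → e = false
  hW1 : Bd (kap Z) B.U1 (m + 1) ≤ W
  hW2 : Bd (kap Z) B.U2 (m + R + 1) ≤ Bd (kap Z) B.U2 (R + 1) + W
  hL : (W + 1) * Fintype.card Z + kap Z * Fintype.card Z ≤ kap Z * v
  hv : 1 ≤ v
  hR : 2 * (W * Fintype.card Z) ≤ R
  R1 : 1 ≤ R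

variable {B : Base S Z} {m R v W : ℕ}

theorem Setup.exH1 (h : Setup B m R v W) {i : ℕ} (hi : Bd (kap Z) B.U1 m ≤ i) (X) : Ex1 B X i := by
  intro p hp _ k x h1 h2 h3
  have := Bd_idx_le (κ := kap Z) (u := B.U1) (k := m) (x := 0) (l := k) (y := x) (by omega) h2
  have := h.feat1 p hp
  omega

theorem Setup.exH2 (h : Setup B m R v W) {j : ℕ} (hj : j < Bd (kap Z) B.U2 (R + 2)) (X) :
    Ex1 B.sw X j := by
  intro p hp _ k x h1 h2 h3
  have h4 : k < R + 2 := (Bd_strictMono (kap Z) B.U2).lt_iff_lt.1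
    (show Bd (kap Z) B.U2 k < _ by change j = Bd (kap Z) B.U2 k + x at h1; omega)
  have := h.feat2 p hp
  change k = B.f2 p at h3
  omega

theorem Setup.exT2 (h : Setup B m R v W) {j : ℕ} (hj : Bd (kap Z) B.U2 (m + R) ≤ j) (X) :
    Ex1 B.sw X j := by
  intro p hp _ k x h1 h2 h3
  have := Bd_idx_le (κ := kap Z) (u := B.U2) (k := m + R) (x := 0) (l := k) (y := x)
    (by change j = Bd (kap Z) B.U2 k + x at h1; omega) h2
  have := h.feat2 p hp
  change k = B.f2 p at h3
  omega

theorem Setup.jle (h : Setup B m R v W) {n z i j z1 i1 j1}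
    (hr : run B.F B.a B.b n z i j = some (z1, i1, j1)) (hj : j ≤ Bd (kap Z) B.U2 (m + R + 1)) :
    j1 ≤ Bd (kap Z) B.U2 (m + R + 1) := by
  by_contra hlt
  push Not at hlt
  obtain ⟨n0, z0, i0, z', e, _, _, h1, _⟩ := run_cross _ ((run_sw B.F B.a B.b).2 hr) hj hlt
  have h2 := (swF_some B.F).1 h1
  have := B.r2 (m + R + 1) 0 (by omega)
  rw [add_zero] at this
  rw [this] at h2
  simpa using h.hend _ _ _ _ _ h2

theorem Setup.G0 (h : Setup B m R v W) (D : ℕ) : ∀ {ka n z j z1 i1 j1}, ka + D = m + R + 1 →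
    m < ka → Bd (kap Z) B.U2 (R + 1) ≤ j → j ≤ Bd (kap Z) B.U2 (m + R + 1) →
    run B.F B.a B.b n z (Bd (kap Z) B.U1 ka) j = some (z1, i1, j1) →
    B.F (B.a i1) (B.b j1) z1 = none → B.acc z1 → Good B 0 1 z (Bd (kap Z) B.U1 ka) j := by
  induction D with
  | zero =>
    intro ka n z j z1 i1 j1 hka hm hj1 hj2 hr hh ha
    obtain ⟨X, hX, hE⟩ := ex1 B.sw j1
    simp only [add_zero] at hka
    subst hka
    exact ((goodInf (B := B.sw) (kb := m + R + 1) h.c1 ((run_sw B.F B.a B.b).2 hr) (le_refl _)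
      ((swF_none B.F).2 hh) ha hE).sw).mono (le_refl _) hX
  | succ D ih =>
    intro ka n z j z1 i1 j1 hka hm hj1 hj2 hr hh ha
    have hu := h.u1H ka hm (by omega)
    have hB := Bd_succ (kap Z) B.U1 ka
    have hexa : Ex1 B [] (Bd (kap Z) B.U1 ka) := h.exH1 (Bd_le (by omega)) []
    have hW2 := h.hW2
    rcases phase (fun i _ => i < Bd (kap Z) B.U1 (ka + 1)) hr (by omega) with
      h1 | ⟨n1, n2, z2, i2, j2, z3, d, e, h1, h2, h3, h4, h5, -⟩
    · obtain ⟨X, hX, hE⟩ := ex1 B.sw j1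
      have hmm := run_mono hr
      have hjl := h.jle hr hj2
      obtain ⟨y, rfl⟩ := Nat.exists_eq_add_of_le hmm.1
      rw [B.r1 ka y (by omega)] at hh
      refine Good.mono (Good.sw ?_) (le_refl _) hX
      exact goodC (B := B.sw) (W := W) ((run_sw B.F B.a B.b).2 hr)
        (show y < 1 + kap Z * B.U1 ka by omega) ((swF_none B.F).2 hh) ha (by omega)
        (by have := h.hL; change _ ≤ kap Z * B.U1 ka; rw [hu]; exact this) hE hexa
    · have hd : d = true := by
        cases d
        · simp at h4; omega
        · rfl
      subst hd
      have hmm := run_mono h1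
      have hjl := h.jle h1 hj2
      simp only [Bool.toNat_true] at h4 h5
      obtain rfl : i2 = Bd (kap Z) B.U1 ka + kap Z * B.U1 ka := by omega
      rw [B.r1 ka _ (by omega)] at h3
      have := trB (B := B.sw) (W := W) ((run_sw B.F B.a B.b).2 h1)
        ((swF_some B.F).2 h3) (by omega)
        (by have := h.hL; change _ ≤ kap Z * B.U1 ka; rw [hu]; exact this) hexa
      obtain ⟨rfl, hT⟩ := this
      simp only [Bool.toNat_false, add_zero] at h5
      have hg := ih (ka := ka + 1) (j := j2) (by omega) (by omega) (by omega) (by omega)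
        (by rw [show Bd (kap Z) B.U1 (ka + 1) = Bd (kap Z) B.U1 ka + kap Z * B.U1 ka + 1 by omega]
            exact h5) hh ha
      exact (Tr.good (Tr.sw hT) hg).mono (by omega) (by omega)

theorem Setup.G1 (h : Setup B m R v W) {n z i j z1 i1 j1}
    (hi : Bd (kap Z) B.U1 (m + 1) ≤ i) (hj1 : Bd (kap Z) B.U2 (R + 1) ≤ j)
    (hj2 : j ≤ Bd (kap Z) B.U2 (m + R + 1))
    (hr : run B.F B.a B.b n z i j = some (z1, i1, j1))
    (hh : B.F (B.a i1) (B.b j1) z1 = none) (ha : B.acc z1) : Good B 1 3 z i j := by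
  by_cases hbig : Bd (kap Z) B.U1 (m + R + 1) ≤ i
  · obtain ⟨X, hX, hE⟩ := ex1 B.sw j1
    exact ((goodInf (B := B.sw) (kb := m + R + 1) h.c1 ((run_sw B.F B.a B.b).2 hr) hbig
      ((swF_none B.F).2 hh) ha hE).sw).mono (by omega) (by omega)
  push Not at hbig
  obtain ⟨ka, x, rfl, hx⟩ := Bd_dec (kap Z) B.U1 i
  have hka : m + 1 ≤ ka := Bd_idx_le (x := 0) (by simpa using hi) hx
  have hka2 : ka < m + R + 1 := (Bd_strictMono (kap Z) B.U1).lt_iff_lt.1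
    (show Bd (kap Z) B.U1 ka < _ by omega)
  have hB := Bd_succ (kap Z) B.U1 ka
  have hBm := Bd_le (κ := kap Z) (u := B.U1) (show m ≤ ka by omega)
  rcases phase (fun i _ => i < Bd (kap Z) B.U1 (ka + 1)) hr (by omega) with
      h1 | ⟨n1, n2, z2, i2, j2, z3, d, e, h1, h2, h3, h4, h5, -⟩
  · obtain ⟨X, hX, hE⟩ := ex1 B.sw j1
    have hmm := run_mono hr
    obtain ⟨y, rfl⟩ := Nat.exists_eq_add_of_le (show Bd (kap Z) B.U1 ka ≤ i1 by omega)
    have hx1 : Ex1 B X (Bd (kap Z) B.U1 ka + x) := h.exH1 (by omega) X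
    have := trA (B := B.sw) (kb := ka) (y := x) (y1 := y) ((run_sw B.F B.a B.b).2 hr)
      (show y < 1 + kap Z * B.U1 ka by omega) hE hx1
    exact (Tr.good (Tr.sw this) (good_halt hh ha)).mono (by omega) (by omega)
  · have hd : d = true := by
      cases d
      · simp at h4; omega
      · rfl
    subst hd
    obtain ⟨X, hX, hE⟩ := ex1 B.sw j2
    have hmm := run_mono h1
    have hjl := h.jle h1 hj2
    have hst := run_trans h1 (run_one B.F B.a B.b h3)
    have hjl2 := h.jle hst hj2
    have hmm2 := run_mono hst
    simp only [Bool.toNat_true] at h4 h5 hst hmm2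
    obtain ⟨y, rfl⟩ := Nat.exists_eq_add_of_le (show Bd (kap Z) B.U1 ka ≤ i2 by omega)
    have hx1 : Ex1 B X (Bd (kap Z) B.U1 ka + x) := h.exH1 (by omega) X
    have t1 := trA (B := B.sw) (kb := ka) (y := x) (y1 := y) ((run_sw B.F B.a B.b).2 h1)
      (show y < 1 + kap Z * B.U1 ka by omega) hE hx1
    have t2 := tr_step h3 (fun _ => h.exH1 (by omega) X) (fun _ => hE)
    have e1 : Bd (kap Z) B.U1 ka + y + 1 = Bd (kap Z) B.U1 (ka + 1) := by omega
    simp only [Bool.toNat_true] at t2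
    rw [e1] at t2 h5
    have g := h.G0 (m + R + 1 - (ka + 1)) (ka := ka + 1) (by omega) (by omega) (by omega)
      (by omega) h5 hh ha
    exact (Tr.good (Tr.trans (Tr.sw t1) t2) g).mono (by omega) (by omega)

theorem Setup.G2 (h : Setup B m R v W) {n : ℕ} : ∀ {z i j z1 i1 j1},
    Bd (kap Z) B.U1 (m + 1) ≤ i →
    j ≤ Bd (kap Z) B.U2 (m + R + 1) →
    run B.F B.a B.b n z i j = some (z1, i1, j1) →
    B.F (B.a i1) (B.b j1) z1 = none → B.acc z1 → Good B 1 3 z i j := by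
  induction n with
  | zero =>
    intro z i j z1 i1 j1 hi hj hr hh ha
    simp only [run_zero, Option.some.injEq, Prod.mk.injEq] at hr
    obtain ⟨rfl, rfl, rfl⟩ := hr
    exact (good_halt hh ha).mono (by omega) (by omega)
  | succ n ih =>
    intro z i j z1 i1 j1 hi hj hr hh ha
    by_cases hj1 : Bd (kap Z) B.U2 (R + 1) ≤ j
    · exact h.G1 hi hj1 hj hr hh ha
    push Not at hj1
    obtain ⟨z', d, e, h1, h2⟩ := (run_succ ..).1 hr
    have hjl := h.jle (run_one B.F B.a B.b h1) hj
    have hb1 := Bd_le (κ := kap Z) (u := B.U1) (show m ≤ m + 1 by omega)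
    have hb2 := Bd_le (κ := kap Z) (u := B.U2) (show R + 1 ≤ R + 2 by omega)
    have t := tr_step h1 (fun _ => h.exH1 (by omega) []) (fun _ => h.exH2 (by omega) [])
    exact (Tr.good t (ih (by omega) hjl h2 hh ha)).mono (by omega) (by simp)

theorem Setup.G3 (h : Setup B m R v W) {n z i z1 i1 j1 ns zs}
    (hs : run B.F B.a B.b ns z i (Bd (kap Z) B.U2 (R + 1)) =
      some (zs, i, Bd (kap Z) B.U2 (m + R + 1)))
    (hr : run B.F B.a B.b n z i (Bd (kap Z) B.U2 (R + 1)) = some (z1, i1, j1))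
    (hh : B.F (B.a i1) (B.b j1) z1 = none) (ha : B.acc z1) :
    Good B 1 3 z i (Bd (kap Z) B.U2 (R + 1)) := by
  have hm := h.m1
  have hB := Bd_succ (kap Z) B.U2 (m + R)
  have hb := Bd_le (κ := kap Z) (u := B.U2) (show R + 1 ≤ m + R by omega)
  obtain ⟨n0, z0, i0, z', d, -, e1, e2, e3⟩ :=
    run_cross (Bd (kap Z) B.U2 (m + R) + kap Z * B.U2 (m + R)) ((run_sw B.F B.a B.b).2 hs)
      (by omega) (by omega)
  have e2' := (swF_some B.F).1 e2
  have m1 := run_mono e1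
  have m3 := run_mono e3
  obtain rfl : i0 = i := by omega
  have hd : d = false := by
    cases d
    · rfl
    · simp at m3
  subst hd
  obtain ⟨X, hX, hE⟩ := ex1 B i0
  obtain ⟨k, x, hk, hx⟩ := Bd_dec (kap Z) B.U1 i0
  have hE2 := h.exT2 (j := Bd (kap Z) B.U2 (m + R) + kap Z * B.U2 (m + R)) (by omega) X
  have t1 : Tr B.sw 1 X.length z (Bd (kap Z) B.U2 (R + 1)) i0 z0
      (Bd (kap Z) B.U2 (m + R) + kap Z * B.U2 (m + R)) i0 := by
    have := trA (B := B.sw) (X := X) (kb := k) (y := x) (y1 := x) (n := n0) (z := z) (z1 := z0)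
      (i := Bd (kap Z) B.U2 (R + 1)) (i1 := Bd (kap Z) B.U2 (m + R) + kap Z * B.U2 (m + R))
      (by change run (swF B.F) B.b B.a _ _ _ (Bd (kap Z) B.U1 k + x) =
            some (_, _, Bd (kap Z) B.U1 k + x)
          rw [← hk]; exact e1) hx hE2 (by
          change Ex1 B X (Bd (kap Z) B.U1 k + x)
          rw [← hk]; exact hE)
    change Tr B.sw 1 X.length z _ (Bd (kap Z) B.U1 k + x) z0 _ (Bd (kap Z) B.U1 k + x) at this
    rw [← hk] at this
    exact this
  have t2 := tr_step e2' (fun _ => hE) (fun _ => hE2)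
  have hrun : run B.F B.a B.b (n0 + 1) z i0 (Bd (kap Z) B.U2 (R + 1)) = some
      (z', i0 + (false).toNat, Bd (kap Z) B.U2 (m + R) + kap Z * B.U2 (m + R) + (true).toNat) :=
    run_trans ((run_sw B.F B.a B.b).1 e1) (run_one B.F B.a B.b e2')
  have hle : n0 + 1 ≤ n := by
    by_contra hlt
    push Not at hlt
    obtain ⟨z5, i5, j5, h5, h6⟩ := run_upto (k := n) (by omega) hrun
    rw [hr] at h5
    simp only [Option.some.injEq, Prod.mk.injEq] at h5
    obtain ⟨rfl, rfl, rfl⟩ := h5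
    obtain ⟨w, hw⟩ := Nat.exists_eq_succ_of_ne_zero (show n0 + 1 - n ≠ 0 by omega)
    rw [hw] at h6
    obtain ⟨_, _, _, h7, _⟩ := (run_succ ..).1 h6
    rw [hh] at h7
    simp at h7
  have hrest := run_rest hle hr hrun
  obtain ⟨Y, hY, hEY⟩ := ex1 B i1
  have g := goodInf (B := B) (kb := m + R + 1) h.c2 hrest (by simp; omega) hh ha hEY
  exact (Tr.good (Tr.trans (Tr.sw t1) t2) g).mono (by omega) (by omega)

end WKP

namespace WKP

open Finset

variable {S Z : Type} [Fintype Z]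

theorem crossing {F : Mach S Z} (hF : Inj F) {a b : ℕ → S} {sy : ℕ → S} {u : ℕ → ℕ}
    (hR : RL (kap Z) a sy u) {n z j z1 k} (hu : 1 ≤ u k)
    (h : run F a b n z (Bd (kap Z) u k) j = some (z1, Bd (kap Z) u (k+1), j)) (l : ℕ)
    (hl : sy l = sy k) :
    (∃ n' z', run F a b n' z (Bd (kap Z) u l) j = some (z', Bd (kap Z) u (l+1), j)) ∧
    (sy (l+1) = sy (k+1) →
      ∃ n', run F a b n' z (Bd (kap Z) u l) j = some (z1, Bd (kap Z) u (l+1), j)) := by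
  have hB := Bd_succ (kap Z) u k
  have hBl := Bd_succ (kap Z) u l
  obtain ⟨n0, z0, j0, z', e, -, e1, e2, e3⟩ :=
    run_cross (Bd (kap Z) u k + kap Z * u k) h (by omega) (by omega)
  have m1 := run_mono e1
  have m3 := run_mono e3
  obtain rfl : j0 = j := by omega
  have he : e = false := by
    cases e
    · rfl
    · simp at m3
  subst he
  simp only [Bool.toNat_false, add_zero] at e3
  rw [hR k _ (by omega)] at e2
  have c1 := run_congr (a' := K (sy k)) (b' := K (b j0)) 0 0 e1
    (fun q hq => hR k q (by omega)) (fun q hq => by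
      obtain rfl : q = 0 := by omega
      rfl)
  rw [show 0 + (Bd (kap Z) u k + kap Z * u k - Bd (kap Z) u k) = kap Z * u k by omega,
    show 0 + (j0 - j0) = 0 by omega] at c1
  obtain ⟨σ, -, -, hall⟩ := cl_cross hF hu c1 e2
  have hσ : σ = 0 := by
    obtain ⟨_, Y', _, h2⟩ := hall 0
    have : u k * σ = 0 := by omega
    rcases Nat.mul_eq_zero.1 this with h | h
    · omega
    · exact h
  subst hσ
  obtain ⟨n', Y', d1, d2⟩ := hall (u l)
  obtain rfl : Y' = 0 := by simpa using d2
  have c2 := run_congr (a' := a) (b' := b) (Bd (kap Z) u l) j0 d1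
    (fun q hq => by rw [hR l q (by omega)]; exact hl.symm) (fun q hq => by
      obtain rfl : q = 0 := by omega
      rfl)
  rw [show Bd (kap Z) u l + (kap Z * u l - 0) = Bd (kap Z) u l + kap Z * u l by omega,
    show j0 + (0 - 0) = j0 by omega] at c2
  have c3 := run_one F a b (i := Bd (kap Z) u l + kap Z * u l) (j := j0)
    (by rw [hR l _ (by omega), hl]; exact e2)
  have c4 := run_trans c2 c3
  simp only [Bool.toNat_false, add_zero, Bool.toNat_true] at c4
  rw [show Bd (kap Z) u l + kap Z * u l + 1 = Bd (kap Z) u (l+1) by omega] at c4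
  refine ⟨⟨_, _, c4⟩, fun hs => ?_⟩
  rw [show Bd (kap Z) u k + kap Z * u k + 1 = Bd (kap Z) u (k+1) by omega] at e3
  have c5 := run_congr (a' := a) (b' := b) (Bd (kap Z) u (l+1)) j0 e3
    (fun q hq => by
      obtain rfl : q = 0 := by omega
      have h1 := hR (k+1) 0 (by omega)
      have h2 := hR (l+1) 0 (by omega)
      rw [h1, h2, hs]) (fun q hq => by
      obtain rfl : q = 0 := by omega
      rfl)
  simp only [Nat.sub_self, add_zero] at c5
  exact ⟨_, run_trans c4 c5⟩

theorem order {F : Mach S Z} {a b : ℕ → S} {n n' z i j z1 i1 j1 z2 i2 j2}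
    (h1 : run F a b n z i j = some (z1, i1, j1)) (h2 : run F a b n' z i j = some (z2, i2, j2))
    (h : i1 < i2) : ∃ r, run F a b r z1 i1 j1 = some (z2, i2, j2) := by
  by_cases hn : n ≤ n'
  · exact ⟨_, run_rest hn h2 h1⟩
  · have := run_mono (run_rest (by omega : n' ≤ n) h1 h2)
    omega

theorem star {F : Mach S Z} (hF : Inj F) {a b : ℕ → S} {sy : ℕ → S} {u : ℕ → ℕ}
    (hRL : RL (kap Z) a sy u) {n0 j m R W : ℕ} {q0 z : Z} (hm : 1 ≤ m)
    (hu : ∀ k, 1 ≤ k → k ≤ R → 1 ≤ u k)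
    (par : ∀ k l, 1 ≤ k → k ≤ m + R → 1 ≤ l → l ≤ m + R → k % 2 = l % 2 → sy k = sy l)
    (hr : run F a b n0 q0 0 0 = some (z, Bd (kap Z) u (R+1), j)) (hj : j < W)
    (hW : 2 * (W * Fintype.card Z) ≤ R) :
    ∃ ns zs, run F a b ns z (Bd (kap Z) u (R+1)) j = some (zs, Bd (kap Z) u (m+R+1), j) := by
  have hg : ∀ k, ∃ n z' j', k ≤ R + 1 →
      (run F a b n q0 0 0 = some (z', Bd (kap Z) u k, j') ∧ j' ≤ j) := by
    intro k
    by_cases hk : k ≤ R + 1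
    · obtain ⟨n, n1, z', j', h1, h2⟩ := run_reach (Bd (kap Z) u k) hr (by omega) (Bd_le hk)
      exact ⟨n, z', j', fun _ => ⟨h1, (run_mono h2).2.1⟩⟩
    · exact ⟨0, z, 0, fun h => absurd h hk⟩
  choose gn gz gj hg using hg
  have hord : ∀ k k', k < k' → k' ≤ R + 1 → ∃ r, run F a b r (gz k) (Bd (kap Z) u k) (gj k) =
      some (gz k', Bd (kap Z) u k', gj k') := fun k k' h1 h2 =>
    order (hg k (by omega)).1 (hg k' h2).1 (Bd_strictMono _ _ h1)
  -- two equal crossing configurations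
  have hpig : ∃ k k', 1 ≤ k ∧ k < k' ∧ k' ≤ R + 1 ∧ k % 2 = k' % 2 ∧ gz k = gz k' ∧ gj k = gj k' := by
    have hle : ∀ s : Fin (W * Fintype.card Z + 1), 1 + 2 * s.1 ≤ R + 1 := fun s => by
      have := s.2
      omega
    obtain ⟨s, s', hne, he⟩ := Fintype.exists_ne_map_eq_of_card_lt
      (fun s : Fin (W * Fintype.card Z + 1) =>
        ((⟨gj (1 + 2 * s.1), by have := (hg _ (hle s)).2; omega⟩ : Fin W), gz (1 + 2 * s.1)))
      (by simp)
    simp only [Prod.mk.injEq, Fin.mk.injEq] at he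
    have hne' : s.1 ≠ s'.1 := fun h => hne (Fin.ext h)
    rcases lt_or_gt_of_ne hne' with h | h
    · exact ⟨_, _, by omega, by omega, hle s', by omega, he.2, he.1⟩
    · exact ⟨_, _, by omega, by omega, hle s, by omega, he.2.symm, he.1.symm⟩
  obtain ⟨k, k', hk1, hkk, hk', hpar, hz, hc⟩ := hpig
  have hconst : ∀ r, k ≤ r → r ≤ k' → gj r = gj k := by
    intro r h1 h2
    rcases Nat.eq_or_lt_of_le h1 with rfl | h1
    · rfl
    rcases Nat.eq_or_lt_of_le h2 with rfl | h2
    · exact hc.symm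
    obtain ⟨_, e1⟩ := hord _ _ h1 (by omega)
    obtain ⟨_, e2⟩ := hord _ _ h2 hk'
    have := run_mono e1
    have := run_mono e2
    omega
  have hstep : ∀ r, k ≤ r → r < k' → ∃ n, run F a b n (gz r) (Bd (kap Z) u r) (gj k) =
      some (gz (r+1), Bd (kap Z) u (r+1), gj k) := by
    intro r h1 h2
    obtain ⟨n, e1⟩ := hord r (r+1) (by omega) (by omega)
    rw [hconst r h1 (by omega), hconst (r+1) (by omega) (by omega)] at e1
    exact ⟨n, e1⟩
  have hind : ∀ d, k + d ≤ m + R → ∃ r n, k ≤ r ∧ r < k' ∧ r % 2 = (k + d) % 2 ∧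
      run F a b n (gz k) (Bd (kap Z) u k) (gj k) = some (gz r, Bd (kap Z) u (k+d), gj k) := by
    intro d
    induction d with
    | zero => exact fun _ => ⟨k, 0, le_refl _, hkk, rfl, rfl⟩
    | succ d ih =>
      intro hd
      obtain ⟨r, n, h1, h2, h3, h4⟩ := ih (by omega)
      obtain ⟨n1, h5⟩ := hstep r h1 h2
      obtain ⟨n2, h6⟩ := (crossing hF hRL (hu r (by omega) (by omega)) h5 (k+d)
        (par _ _ (by omega) (by omega) (by omega) (by omega) h3.symm)).2
        (par _ _ (by omega) (by omega) (by omega) (by omega) (by omega))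
      have h7 := run_trans h4 h6
      by_cases hrk : r + 1 = k'
      · have hzz : gz (r+1) = gz k := by rw [hrk, hz]
        rw [hzz] at h7
        exact ⟨k, _, le_refl _, hkk, by omega, h7⟩
      · exact ⟨r+1, _, by omega, by omega, by omega, h7⟩
  obtain ⟨r, n, h1, h2, h3, h4⟩ := hind (m + R - k) (by omega)
  rw [show k + (m + R - k) = m + R by omega] at h3 h4
  obtain ⟨n1, h5⟩ := hstep r h1 h2
  obtain ⟨n2, zs, h6⟩ := (crossing hF hRL (hu r (by omega) (by omega)) h5 (m+R)
        (par _ _ (by omega) (by omega) (by omega) (by omega) h3.symm)).1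
  have h7 := run_trans (hg k (by omega)).1 (run_trans h4 h6)
  obtain ⟨r1, h8⟩ := order (hg k (by omega)).1 hr (Bd_strictMono _ _ (by omega))
  obtain ⟨r2, h9⟩ := order hr h7 (Bd_strictMono _ _ (by omega))
  have := run_mono h8
  have := run_mono h9
  obtain rfl : j = gj k := by omega
  exact ⟨_, _, h9⟩

end WKP

namespace WKP

open Finset

variable {S Z : Type} [Fintype Z] {B : Base S Z} {m R v W : ℕ}

theorem Setup.star (h : Setup B m R v W) {n0 i : ℕ} {q0 z : Z} (hi : i < Bd (kap Z) B.U1 (m + 1))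
    (hr : run B.F B.a B.b n0 q0 0 0 = some (z, i, Bd (kap Z) B.U2 (R + 1))) :
    ∃ ns zs, run B.F B.a B.b ns z i (Bd (kap Z) B.U2 (R + 1)) =
      some (zs, i, Bd (kap Z) B.U2 (m + R + 1)) := by
  have hW := h.hW1
  obtain ⟨ns, zs, h1⟩ := WKP.star B.hF.sw B.r2 (W := W) h.m1
    (fun k h1 h2 => by rw [h.u2H k h1 h2]; exact h.hv) h.par ((run_sw B.F B.a B.b).2 hr)
    (by omega) h.hR
  exact ⟨ns, zs, (run_sw B.F B.a B.b).1 h1⟩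

theorem Setup.G4aux (h : Setup B m R v W) {q0 : Z} {kb n n0 z i z1 i1 j1}
    (hkb : kb ≤ R) (hk1 : 1 ≤ kb) (hi : i < Bd (kap Z) B.U1 (m + 1))
    (h0 : run B.F B.a B.b n0 q0 0 0 = some (z, i, Bd (kap Z) B.U2 kb))
    (hr : run B.F B.a B.b n z i (Bd (kap Z) B.U2 kb) = some (z1, i1, j1))
    (hh : B.F (B.a i1) (B.b j1) z1 = none) (ha : B.acc z1)
    (ih : ∀ n n0 z i, i < Bd (kap Z) B.U1 (m + 1) →
      run B.F B.a B.b n0 q0 0 0 = some (z, i, Bd (kap Z) B.U2 (kb + 1)) →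
      run B.F B.a B.b n z i (Bd (kap Z) B.U2 (kb + 1)) = some (z1, i1, j1) →
      Good B 2 3 z i (Bd (kap Z) B.U2 (kb + 1))) :
    Good B 2 3 z i (Bd (kap Z) B.U2 kb) := by
  have hu := h.u2H kb hk1 hkb
  have hB := Bd_succ (kap Z) B.U2 kb
  have hB1 := Bd_succ (kap Z) B.U1 m
  have hb1 := Bd_le (κ := kap Z) (u := B.U2) (show kb + 1 ≤ R + 1 by omega)
  have hb2 := Bd_strictMono (kap Z) B.U2 (show R + 1 < R + 2 by omega)
  have hb3 := Bd_le (κ := kap Z) (u := B.U2) (show R + 1 ≤ m + R + 1 by omega)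
  have hW := h.hW1
  have hL : (W + 1) * Fintype.card Z + kap Z * Fintype.card Z ≤ kap Z * B.U2 kb := by
    rw [hu]; exact h.hL
  rcases phase (fun i j => i < Bd (kap Z) B.U1 (m + 1) ∧ j < Bd (kap Z) B.U2 (kb + 1)) hr
    ⟨hi, by omega⟩ with h1 | ⟨n1, n2, z2, i2, j2, z3, d, e, h1, h2, h3, h4, h5, -⟩
  · obtain ⟨X, hX, hE⟩ := ex1 B i1
    have hmm := run_mono hr
    obtain ⟨y, rfl⟩ := Nat.exists_eq_add_of_le hmm.2.1
    rw [B.r2 kb y (by omega)] at hh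
    exact (goodC (W := W) hr (by omega) hh ha (by omega) hL hE
      (h.exH2 (by omega) [])).mono (by omega) (by omega)
  · have hmm := run_mono h1
    have hall := run_trans h0 (run_trans h1 (run_one B.F B.a B.b h3))
    by_cases hj : j2 + e.toNat < Bd (kap Z) B.U2 (kb + 1)
    · have hi' : Bd (kap Z) B.U1 (m + 1) ≤ i2 + d.toNat := by
        by_contra hlt
        exact h4 ⟨by omega, hj⟩
      have hd : d.toNat ≤ 1 := Bool.toNat_le d
      obtain ⟨y, rfl⟩ := Nat.exists_eq_add_of_le hmm.2.1
      have t1 := trA (y := 0) (X := []) h1 (by omega) (h.exH1 (by omega) []) (h.exH2 (by omega) [])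
      have t2 := tr_step (X := []) h3 (fun _ => h.exH1 (by omega) [])
        (fun _ => h.exH2 (by omega) [])
      exact (Tr.good (Tr.trans t1 t2) (h.G2 hi' (by omega) h5 hh ha)).mono (by omega)
        (by simp)
    · have he : e = true := by
        cases e
        · simp at hj; omega
        · rfl
      subst he
      simp only [Bool.toNat_true] at *
      obtain rfl : j2 = Bd (kap Z) B.U2 kb + kap Z * B.U2 kb := by omega
      rw [B.r2 kb _ (by omega)] at h3
      obtain ⟨rfl, hT⟩ := trB (W := W) h1 h3 (by omega) hL (h.exH2 (by omega) [])
      simp only [Bool.toNat_false, add_zero] at *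
      rw [show Bd (kap Z) B.U2 kb + kap Z * B.U2 kb + 1 = Bd (kap Z) B.U2 (kb + 1) by omega]
        at h5 hall
      exact (Tr.good hT (ih _ _ _ _ h2.1 hall h5)).mono (by omega) (by omega)

theorem Setup.G4 (h : Setup B m R v W) {q0 : Z} (D : ℕ) : ∀ {kb n n0 z i z1 i1 j1},
    kb + D = R → 1 ≤ kb → i < Bd (kap Z) B.U1 (m + 1) →
    run B.F B.a B.b n0 q0 0 0 = some (z, i, Bd (kap Z) B.U2 kb) →
    run B.F B.a B.b n z i (Bd (kap Z) B.U2 kb) = some (z1, i1, j1) →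
    B.F (B.a i1) (B.b j1) z1 = none → B.acc z1 → Good B 2 3 z i (Bd (kap Z) B.U2 kb) := by
  induction D with
  | zero =>
    intro kb n n0 z i z1 i1 j1 hkb hk1 hi h0 hr hh ha
    obtain rfl : kb = R := by omega
    refine h.G4aux (by omega) hk1 hi h0 hr hh ha ?_
    intro n n0 z i h1 h2 h3
    obtain ⟨ns, zs, hs⟩ := h.star h1 h2
    exact (h.G3 hs h3 hh ha).mono (by omega) (by omega)
  | succ D ih =>
    intro kb n n0 z i z1 i1 j1 hkb hk1 hi h0 hr hh ha
    refine h.G4aux (by omega) hk1 hi h0 hr hh ha ?_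
    intro n n0 z i h1 h2 h3
    exact ih (by omega) (by omega) h1 h2 h3 hh ha

theorem Setup.G5 (h : Setup B m R v W) {q0 : Z} (hA : AccF B.F B.acc B.a B.b q0 0 0) :
    Good B 3 5 q0 0 0 := by
  obtain ⟨n, z1, i1, j1, hr, hh, ha⟩ := hA
  have hR1 := h.R1
  have hB2 : Bd (kap Z) B.U2 1 = 1 := by rw [Bd_succ, h.u20]; simp
  have hB1 := Bd_succ (kap Z) B.U1 m
  have hb1 := Bd_le (κ := kap Z) (u := B.U2) (show 1 ≤ m + R + 1 by omega)
  have hb2 := Bd_strictMono (kap Z) B.U2 (show 1 < R + 2 by omega)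
  have h0k : 1 ≤ 1 + kap Z * B.U2 0 := by omega
  rcases phase (fun i j => i < Bd (kap Z) B.U1 (m + 1) ∧ j < 1) hr
    ⟨by omega, by omega⟩ with h1 | ⟨n1, n2, z2, i2, j2, z3, d, e, h1, h2, h3, h4, h5, -⟩
  · obtain ⟨X, hX, hE⟩ := ex1 B i1
    have hj0 : j1 = 0 := by omega
    subst hj0
    have t := trA (B := B) (X := X) (kb := 0) (y := 0) (y1 := 0) (by simpa using hr) (by omega) hE
      (h.exH2 (by simp; omega) X)
    simp only [Bd_zero, add_zero] at t
    exact (Tr.good t (good_halt hh ha)).mono (by omega) (by omega)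
  · obtain ⟨X, hX, hE⟩ := ex1 B i2
    have hj0 : j2 = 0 := by omega
    subst hj0
    have hall := run_trans h1 (run_one B.F B.a B.b h3)
    have t := trA (B := B) (X := X) (kb := 0) (y := 0) (y1 := 0) (by simpa using h1) (by omega) hE
      (h.exH2 (by simp; omega) X)
    simp only [Bd_zero, add_zero] at t
    have t2 := tr_step h3 (fun _ => hE) (fun _ => h.exH2 (by omega) X)
    have t3 := Tr.trans t t2
    have he := Bool.toNat_le e
    by_cases hi : i2 + d.toNat < Bd (kap Z) B.U1 (m + 1)
    · have he1 : 0 + e.toNat = Bd (kap Z) B.U2 1 := by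
        by_contra hne
        exact h4 ⟨hi, by omega⟩
      rw [he1] at h5 hall t3
      exact (Tr.good t3 (h.G4 (R - 1) (by omega) (by omega) hi hall h5 hh ha)).mono
        (by omega) (by omega)
    · exact (Tr.good t3 (h.G2 (by omega) (by omega) h5 hh ha)).mono (by omega) (by omega)

/-- if there are many features, some variant is accepted as well -/
theorem Setup.final (h : Setup B m R v W) {q0 : Z} (hA : AccF B.F B.acc B.a B.b q0 0 0)
    (T : Finset ℕ) (hT : ∀ p ∈ T, B.Feat p)
    (hc : 5 + (kap Z * Fintype.card Z + 1) ^ 3 < T.card) :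
    ∃ p ∈ T, ∃ q ∈ T, p ≠ q ∧ ∀ U1 U2 a b, Vr B p q U1 U2 a b → AccF B.F B.acc a b q0 0 0 := by
  obtain ⟨L, X, hL, hX, hb, hg⟩ := h.G5 hA
  have hcard : (T \ X.toFinset).card > (kap Z * Fintype.card Z + 1) ^ 3 := by
    have h1 := Finset.le_card_sdiff X.toFinset T
    have h2 := X.toFinset_card_le
    omega
  let φ : ℕ → (Fin L.length → Fin (kap Z * Fintype.card Z + 1)) := fun p s =>
    ⟨L[s] p, Nat.lt_succ_of_le (hb _ (List.getElem_mem _) p)⟩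
  obtain ⟨p, hp, q, hq, hne, he⟩ := Finset.exists_ne_map_eq_of_card_lt_of_maps_to
    (s := T \ X.toFinset) (t := Finset.univ) (f := φ)
    (by
      simp only [Finset.card_univ, Fintype.card_pi, Fintype.card_fin, Finset.prod_const]
      exact lt_of_le_of_lt (Nat.pow_le_pow_right (by omega) hL) hcard) (by intro x _; simp)
  simp only [Finset.mem_sdiff, List.mem_toFinset] at hp hq
  refine ⟨p, hp.1, q, hq.1, hne, fun U1 U2 a b hV => hg p q U1 U2 a b hV hp.2 hq.2 ?_ 0 0 ?_ ?_⟩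
  · intro σ hσ
    obtain ⟨s, hs, rfl⟩ := List.getElem_of_mem hσ
    have := congrFun he ⟨s, hs⟩
    simpa [φ] using this
  · simpa using Corr.start (κ := kap Z) (U := B.U1) (U' := U1) 0
  · simpa using Corr.start (κ := kap Z) (U := B.U2) (U' := U2) 0

end WKP

namespace WKP

open WK

theorem accepts_iff {α : Type} (A : DPWK α) (w : List α) :
    Accepts A w ↔ ∃ c, Relation.ReflTransGen (Step A w) (initConf A w) c ∧ Halted A w c ∧
      AccConf A c := by
  constructor
  · rintro ⟨cs, h1, h2, c, h3, h4, h5⟩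
    refine ⟨c, ?_, h4, h5⟩
    generalize initConf A w = c0 at h1
    induction cs generalizing c0 with
    | nil => simp at h1
    | cons x cs ih =>
      simp only [List.head?_cons, Option.some.injEq] at h1
      subst h1
      cases cs with
      | nil =>
        simp only [List.getLast?_singleton, Option.some.injEq] at h3
        subst h3
        exact .refl
      | cons y cs =>
        have h2' := List.isChain_cons_cons.1 h2
        exact .head h2'.1 (ih h2'.2 (by simpa using h3) y rfl)
  · rintro ⟨c, h1, h4, h5⟩
    suffices h : ∃ cs : List (Config A), cs.head? = some (initConf A w) ∧
        List.IsChain (Step A w) cs ∧ cs.getLast? = some c by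
      obtain ⟨cs, e1, e2, e3⟩ := h
      exact ⟨cs, e1, e2, c, e3, h4, h5⟩
    generalize initConf A w = c0 at h1
    induction h1 using Relation.ReflTransGen.head_induction_on with
    | refl => exact ⟨[c], by simp, by simp, by simp⟩
    | head hs _ ih =>
      obtain ⟨cs, e1, e2, e3⟩ := ih
      cases cs with
      | nil => simp at e1
      | cons y cs =>
        simp only [List.head?_cons, Option.some.injEq] at e1
        subst e1
        exact ⟨_ :: y :: cs, rfl, List.isChain_cons_cons.2 ⟨hs, e2⟩, by simpa using e3⟩

theorem tape_zero {α : Type} (w : List α) : tape w 0 = Sum.inr false := by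
  simp [tape]

theorem tape_succ {α : Type} (w : List α) (i : ℕ) :
    tape w (i+1) = (w[i]?).elim (Sum.inr true) Sum.inl := by
  unfold tape
  simp only [List.cons_append, List.getD_eq_getElem?_getD, List.getElem?_cons_succ]
  rcases lt_or_ge i w.length with h | h
  · rw [List.getElem?_append_left (by simpa using h)]
    simp [h]
  · rw [List.getElem?_append_right (by simpa using h)]
    simp only [List.length_map]
    rw [List.getElem?_eq_none h]
    rcases Nat.eq_zero_or_pos (i - w.length) with h1 | h1
    · simp [h1]
    · rw [List.getElem?_eq_none (by simp; omega)]; simp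

theorem tape_inr_false {α : Type} {w : List α} {i : ℕ} (h : tape w i = Sum.inr false) : i = 0 := by
  cases i with
  | zero => rfl
  | succ i =>
    rw [tape_succ] at h
    cases hw : w[i]? <;> simp [hw] at h

theorem tape_end {α : Type} {w : List α} {i : ℕ} : tape w i = Sum.inr true ↔ w.length < i := by
  cases i with
  | zero => simp [tape_zero]
  | succ i =>
    rw [tape_succ]
    rcases lt_or_ge i w.length with h | h
    · rw [List.getElem?_eq_getElem h]; simp; omega
    · rw [List.getElem?_eq_none h]; simp; omega

instance zFin (A : DPWK Bool) : Fintype (A.Q1 × A.Q2) := @instFintypeProd _ _ A.fQ1 A.fQ2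

/-- the joint transition function -/
def mF (A : DPWK Bool) : Mach (TSym Bool) (A.Q1 × A.Q2) := fun s t z =>
  (A.δ1 z.1 s (A.μ2 z.2 t)).bind fun r => (A.δ2 z.2 t (A.μ1 z.1 s)).bind fun r' =>
    if t = Sum.inr false ∧ r'.2 = true then none else some ((r.1, r'.1), r.2, r'.2)

theorem mF_some (A : DPWK Bool) {s t z z' d e} : mF A s t z = some (z', d, e) ↔
    A.δ1 z.1 s (A.μ2 z.2 t) = some (z'.1, d) ∧ A.δ2 z.2 t (A.μ1 z.1 s) = some (z'.2, e) ∧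
      ¬ (t = Sum.inr false ∧ e = true) := by
  unfold mF
  simp only [Option.bind_eq_some_iff]
  constructor
  · rintro ⟨⟨p, d1⟩, h1, ⟨q, d2⟩, h2, h3⟩
    split_ifs at h3 with h4
    simp only [Option.some.injEq, Prod.mk.injEq] at h3
    obtain ⟨rfl, rfl, rfl⟩ := h3
    exact ⟨h1, h2, h4⟩
  · rintro ⟨h1, h2, h3⟩
    exact ⟨_, h1, _, h2, by rw [if_neg h3]⟩

def mAcc (A : DPWK Bool) (z : A.Q1 × A.Q2) : Prop := z.1 ∈ A.F1 ∨ z.2 ∈ A.F2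

theorem sym_ex (s : TSym Bool) : ∃ i, tape [false, true] i = s := by
  rcases s with (_ | _) | (_ | _)
  · exact ⟨1, rfl⟩
  · exact ⟨2, rfl⟩
  · exact ⟨0, rfl⟩
  · exact ⟨3, rfl⟩

theorem mF_inj (A : DPWK Bool) (Wit : RevWitness A) : Inj (mF A) := by
  have key : ∀ s t z z' d e, mF A s t z = some (z', d, e) →
      ∃ d1 d2, Wit.δ'1 z'.1 s (Wit.μ'2 z'.2 t) = some (z.1, d1) ∧
        Wit.δ'2 z'.2 t (Wit.μ'1 z'.1 s) = some (z.2, d2) := by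
    intro s t z z' d e h
    obtain ⟨h1, h2, h3⟩ := (mF_some A).1 h
    obtain ⟨i, hi⟩ := sym_ex s
    obtain ⟨j, hj⟩ := sym_ex t
    have hs : Step A [false, true] ⟨z.1, i, z.2, j⟩ ⟨z'.1, i + cond d 1 0, z'.2, j - cond e 1 0⟩ := by
      refine ⟨d, e, by simpa [hi, hj] using h1, by simpa [hi, hj] using h2, rfl, ?_⟩
      cases e
      · simp
      · have : j ≠ 0 := by
          rintro rfl
          rw [tape_zero] at hj
          exact h3 ⟨hj.symm, rfl⟩
        simp; omega
    obtain ⟨d1, d2, e1, e2, -, -⟩ := (Wit.inverse _ _ _).2 hs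
    simp only [hi, hj] at e1 e2
    exact ⟨d1, d2, e1, e2⟩
  intro s t z1 z2 z' d e d' e' h1 h2
  obtain ⟨_, _, a1, a2⟩ := key _ _ _ _ _ _ h1
  obtain ⟨_, _, b1, b2⟩ := key _ _ _ _ _ _ h2
  rw [a1] at b1
  rw [a2] at b2
  simp only [Option.some.injEq, Prod.mk.injEq] at b1 b2
  exact Prod.ext b1.1 b2.1

theorem step_iff (A : DPWK Bool) (w : List Bool) (c c' : Config A) : Step A w c c' ↔
    ∃ d e : Bool, mF A (tape w c.i) (tape w c.j) (c.p, c.q) = some ((c'.p, c'.q), d, e) ∧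
      c'.i = c.i + d.toNat ∧ c.j = c'.j + e.toNat := by
  have hb : ∀ b : Bool, cond b 1 0 = b.toNat := fun b => by cases b <;> rfl
  constructor
  · rintro ⟨d, e, h1, h2, h3, h4⟩
    rw [hb] at h3 h4
    refine ⟨d, e, (mF_some A).2 ⟨h1, h2, ?_⟩, h3, h4⟩
    rintro ⟨h5, rfl⟩
    have := tape_inr_false h5
    simp at h4
    omega
  · rintro ⟨d, e, h1, h3, h4⟩
    obtain ⟨h5, h6, -⟩ := (mF_some A).1 h1
    exact ⟨d, e, h5, h6, by rw [hb]; exact h3, by rw [hb]; exact h4⟩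

theorem halted_iff (A : DPWK Bool) (w : List Bool) (c : Config A) : Halted A w c ↔
    mF A (tape w c.i) (tape w c.j) (c.p, c.q) = none := by
  unfold Halted
  constructor
  · intro h
    by_contra hne
    obtain ⟨⟨⟨p, q⟩, d, e⟩, h1⟩ := Option.ne_none_iff_exists'.1 hne
    refine h ⟨⟨p, c.i + d.toNat, q, c.j - e.toNat⟩, (step_iff A w _ _).2 ⟨d, e, h1, rfl, ?_⟩⟩
    cases e
    · simp
    · have := ((mF_some A).1 h1).2.2
      have : c.j ≠ 0 := by
        intro h0
        rw [h0, tape_zero] at this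
        simp at this
      simp; omega
  · rintro h ⟨c', hs⟩
    obtain ⟨d, e, h1, -⟩ := (step_iff A w _ _).1 hs
    rw [h] at h1
    simp at h1

theorem accepts_accF (A : DPWK Bool) (w : List Bool) : Accepts A w ↔
    AccF (mF A) (mAcc A) (tape w) (fun p => tape w (w.length + 1 - p)) (A.q01, A.q02) 0 0 := by
  rw [accepts_iff]
  constructor
  · rintro ⟨c, h1, h2, h3⟩
    have key : ∀ c0 : Config A, Relation.ReflTransGen (Step A w) c0 c → c0.j ≤ w.length + 1 →
        AccF (mF A) (mAcc A) (tape w) (fun p => tape w (w.length + 1 - p)) (c0.p, c0.q) c0.i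
          (w.length + 1 - c0.j) := by
      intro c0 h
      induction h using Relation.ReflTransGen.head_induction_on with
      | refl =>
        intro hj
        refine ⟨0, _, _, _, rfl, ?_, h3⟩
        beta_reduce
        rw [show w.length + 1 - (w.length + 1 - c.j) = c.j by omega]
        exact (halted_iff A w c).1 h2
      | @head c1 c2 hs _ ih =>
        intro hj
        obtain ⟨d, e, h5, h6, h7⟩ := (step_iff A w _ _).1 hs
        obtain ⟨n, z1, i1, j1, e1, e2, e3⟩ := ih (by omega)
        refine ⟨n+1, z1, i1, j1, (run_succ ..).2 ⟨(c2.p, c2.q), d, e, ?_, ?_⟩, e2, e3⟩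
        · beta_reduce
          rw [show w.length + 1 - (w.length + 1 - c1.j) = c1.j by omega]
          exact h5
        · rw [← h6, show w.length + 1 - c1.j + e.toNat = w.length + 1 - c2.j by omega]
          exact e1
    simpa [initConf] using key _ h1 (by simp [initConf])
  · rintro ⟨n, z1, i1, j1, e1, e2, e3⟩
    have key : ∀ n (c0 : Config A), c0.j ≤ w.length + 1 → run (mF A) (tape w)
        (fun p => tape w (w.length + 1 - p)) n (c0.p, c0.q) c0.i (w.length + 1 - c0.j) =
          some (z1, i1, j1) →
        ∃ c, Relation.ReflTransGen (Step A w) c0 c ∧ Halted A w c ∧ AccConf A c := by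
      intro n
      induction n with
      | zero =>
        intro c0 hj h
        simp only [run_zero, Option.some.injEq, Prod.mk.injEq] at h
        obtain ⟨rfl, rfl, rfl⟩ := h
        refine ⟨c0, .refl, (halted_iff A w c0).2 ?_, e3⟩
        beta_reduce at e2
        rw [show w.length + 1 - (w.length + 1 - c0.j) = c0.j by omega] at e2
        exact e2
      | succ n ih =>
        intro c0 hj h
        obtain ⟨z', d, e, h1, h2⟩ := (run_succ ..).1 h
        beta_reduce at h1
        rw [show w.length + 1 - (w.length + 1 - c0.j) = c0.j by omega] at h1
        have he : c0.j = c0.j - e.toNat + e.toNat := by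
          cases e
          · simp
          · have := ((mF_some A).1 h1).2.2
            have : c0.j ≠ 0 := by
              intro h0
              rw [h0, tape_zero] at this
              simp at this
            simp; omega
        have hs : Step A w c0 ⟨z'.1, c0.i + d.toNat, z'.2, c0.j - e.toNat⟩ :=
          (step_iff A w _ _).2 ⟨d, e, h1, rfl, he⟩
        obtain ⟨c, g1, g2⟩ := ih ⟨z'.1, c0.i + d.toNat, z'.2, c0.j - e.toNat⟩ (by simp; omega) (by
          simp only
          rw [show w.length + 1 - (c0.j - e.toNat) = w.length + 1 - c0.j + e.toNat by omega]
          exact h2)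
        exact ⟨c, .head hs g1, g2⟩
    exact key n (initConf A w) (by simp [initConf]) (by simpa [initConf] using e1)

end WKP

namespace WKP

open WK

/-- letter of the block with index `k` -/
def lt2 (k : ℕ) : Bool := decide (k % 2 = 0)

/-- the word with blocks `1, …, M` -/
def wd (κ : ℕ) (u : ℕ → ℕ) : ℕ → List Bool
  | 0 => []
  | M + 1 => wd κ u M ++ List.replicate (1 + κ * u (M + 1)) (lt2 (M + 1))

def syW (M k : ℕ) : TSym Bool :=
  if k = 0 then Sum.inr false else if k ≤ M then Sum.inl (lt2 k) else Sum.inr true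

theorem wd_length (κ : ℕ) (u : ℕ → ℕ) (h0 : u 0 = 0) (M : ℕ) :
    (wd κ u M).length + 1 = Bd κ u (M + 1) := by
  induction M with
  | zero => simp [wd, Bd_succ, h0]
  | succ M ih => rw [Bd_succ, ← ih]; simp [wd]; omega

theorem wd_get (κ : ℕ) (u : ℕ → ℕ) (h0 : u 0 = 0) (M k x : ℕ) (h1 : k + 1 ≤ M)
    (hx : x < 1 + κ * u (k + 1)) :
    ∃ i, Bd κ u (k + 1) + x = i + 1 ∧ (wd κ u M)[i]? = some (lt2 (k + 1)) := by
  induction M with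
  | zero => omega
  | succ M ih =>
    have hl := wd_length κ u h0 M
    rcases Nat.lt_or_ge M (k + 1) with h | h
    · obtain rfl : M = k := by omega
      refine ⟨(wd κ u M).length + x, by omega, ?_⟩
      simp only [wd]
      rw [List.getElem?_append_right (by omega)]
      simp [List.getElem?_replicate, hx]
    · obtain ⟨i, e1, e2⟩ := ih h
      refine ⟨i, e1, ?_⟩
      simp only [wd]
      rw [List.getElem?_append_left, e2]
      exact (List.getElem?_eq_some_iff.1 e2).1

theorem wd_RL (κ : ℕ) (u : ℕ → ℕ) (h0 : u 0 = 0) (M : ℕ) : RL κ (tape (wd κ u M)) (syW M) u := by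
  intro k x hx
  cases k with
  | zero =>
    obtain rfl : x = 0 := by rw [h0] at hx; omega
    simp [syW, tape_zero]
  | succ k =>
    by_cases h : k + 1 ≤ M
    · obtain ⟨i, e1, e2⟩ := wd_get κ u h0 M k x h hx
      rw [e1, tape_succ, e2]
      simp [syW, h]
    · have hl := wd_length κ u h0 M
      have := Bd_le (κ := κ) (u := u) (show M + 1 ≤ k + 1 by omega)
      rw [tape_end.2 (by omega)]
      simp [syW, h]

theorem Bd_rev (κ : ℕ) (u : ℕ → ℕ) (M k : ℕ) (hk : k ≤ M + 1) :
    Bd κ (fun r => u (M + 1 - r)) k + Bd κ u (M + 2 - k) = Bd κ u (M + 2) := by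
  induction k with
  | zero => simp
  | succ k ih =>
    rw [← ih (by omega), Bd_succ, show M + 2 - k = (M + 2 - (k + 1)) + 1 by omega, Bd_succ,
      show M + 2 - (k + 1) = M + 1 - k by omega]
    omega

theorem wd_RL2 (κ : ℕ) (u : ℕ → ℕ) (h0 : u 0 = 0) (M : ℕ) (hM : u (M + 1) = 0) :
    RL κ (fun p => tape (wd κ u M) ((wd κ u M).length + 1 - p)) (fun k => syW M (M + 1 - k))
      (fun k => u (M + 1 - k)) := by
  intro k x hx
  have hl := wd_length κ u h0 M
  have hB : Bd κ u (M + 2) = Bd κ u (M + 1) + 1 := by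
    have := Bd_succ κ u (M + 1)
    rw [hM] at this
    simpa using this
  beta_reduce
  by_cases hk : k ≤ M + 1
  · have h1 := Bd_rev κ u M k hk
    have h2 := Bd_succ κ u (M + 1 - k)
    rw [show M + 1 - k + 1 = M + 2 - k by omega] at h2
    beta_reduce at hx
    rw [show (wd κ u M).length + 1 - (Bd κ (fun k => u (M + 1 - k)) k + x) =
      Bd κ u (M + 1 - k) + (κ * u (M + 1 - k) - x) by omega]
    exact wd_RL κ u h0 M _ _ (by omega)
  · have h1 := Bd_rev κ u M (M + 1) (by omega)
    have h2 := Bd_le (κ := κ) (u := fun k => u (M + 1 - k)) (show M + 1 ≤ k by omega)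
    have h3 := Bd_succ κ u 0
    rw [h0, Bd_zero] at h3
    rw [show M + 2 - (M + 1) = 0 + 1 by omega] at h1
    rw [show (wd κ u M).length + 1 - (Bd κ (fun k => u (M + 1 - k)) k + x) = 0 by omega, tape_zero]
    simp [syW, show M + 1 - k = 0 by omega]

/-- block lengths of the base word -/
def uB (m R v k : ℕ) : ℕ :=
  if k = 0 then 0 else if k ≤ m then 1 else if k ≤ m + R then v else 0

def uV (u : ℕ → ℕ) (p q : ℕ) : ℕ → ℕ := Function.update (Function.update u p 0) q 2

theorem uV_Md (u : ℕ → ℕ) {p q : ℕ} (h : p ≠ q) (hp : u p = 1) (hq : u q = 1) :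
    Md u (uV u p q) p q where
  ne := h
  up := hp
  uq := hq
  up' := by simp [uV, h]
  uq' := by simp [uV]
  eq := fun r h1 h2 => by simp [uV, h1, h2]

theorem Md_rev {u u' : ℕ → ℕ} {p q N : ℕ} (h : Md u u' p q) (hp : 1 ≤ p) (hq : 1 ≤ q) (hp' : p ≤ N)
    (hq' : q ≤ N) : Md (fun k => u (N - k)) (fun k => u' (N - k)) (N - p) (N - q) where
  ne := by have := h.ne; omega
  up := by rw [show N - (N - p) = p by omega]; exact h.up
  uq := by rw [show N - (N - q) = q by omega]; exact h.uq
  up' := by rw [show N - (N - p) = p by omega]; exact h.up'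
  uq' := by rw [show N - (N - q) = q by omega]; exact h.uq'
  eq := fun r h1 h2 => h.eq _ (by omega) (by omega)

/-- the base word data -/
def bs (A : DPWK Bool) (Wit : RevWitness A) (m R v : ℕ) (hR : 1 ≤ R) :
    Base (TSym Bool) (A.Q1 × A.Q2) where
  F := mF A
  acc := mAcc A
  hF := mF_inj A Wit
  sy1 := syW (m + R)
  sy2 := fun k => syW (m + R) (m + R + 1 - k)
  U1 := uB m R v
  U2 := fun k => uB m R v (m + R + 1 - k)
  a := tape (wd (kap (A.Q1 × A.Q2)) (uB m R v) (m + R))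
  b := fun p => tape (wd (kap (A.Q1 × A.Q2)) (uB m R v) (m + R))
    ((wd (kap (A.Q1 × A.Q2)) (uB m R v) (m + R)).length + 1 - p)
  r1 := wd_RL _ _ (by simp [uB]) _
  r2 := wd_RL2 _ _ (by simp [uB]) _ (by simp [uB])
  Feat := fun p => p % 2 = 0 ∧ 2 ≤ p ∧ p < m
  f1 := id
  f2 := fun p => m + R + 1 - p
  i1 := fun _ _ _ _ h => h
  i2 := fun p q h1 h2 h => by omega

theorem Bd_grow (κ : ℕ) (u : ℕ → ℕ) (k t : ℕ) (h : ∀ r, k ≤ r → r < k + t → u r ≤ 1) :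
    Bd κ u (k + t) ≤ Bd κ u k + t * (1 + κ) := by
  induction t with
  | zero => simp
  | succ t ih =>
    have h1 := ih fun r h1 h2 => h r h1 (by omega)
    have h2 := h (k + t) (by omega) (by omega)
    have h3 : κ * u (k + t) ≤ κ := by simpa using Nat.mul_le_mul_left κ h2
    rw [← add_assoc, Bd_succ, Nat.succ_mul]
    omega

theorem bs_setup (A : DPWK Bool) (Wit : RevWitness A) (m W R v : ℕ) (hm : 1 ≤ m)
    (hR1 : 1 ≤ R) (hW : W = (m + 1) * (1 + kap (A.Q1 × A.Q2)))
    (hv : v = (W + 1) * Fintype.card (A.Q1 × A.Q2) +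
      kap (A.Q1 × A.Q2) * Fintype.card (A.Q1 × A.Q2) + 1)
    (hR : 2 * (W * Fintype.card (A.Q1 × A.Q2)) ≤ R) :
    Setup (bs A Wit m R v hR1) m R v W where
  m1 := hm
  u1H := fun k h1 h2 => by simp only [bs, uB]; split_ifs <;> omega
  u2H := fun k h1 h2 => by simp only [bs, uB]; split_ifs <;> omega
  u20 := by simp only [bs, uB]; split_ifs <;> omega
  feat1 := fun p h => h.2.2
  feat2 := fun p h => by
    obtain ⟨-, h1, h2⟩ := h
    simp only [bs]
    omega
  c1 := fun k h => by
    simp only [bs, syW]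
    rw [if_neg (by omega), if_neg (by omega), if_neg (by omega), if_neg (by omega)]
  c2 := fun k h => by
    simp only [bs, syW]
    rw [if_pos (by omega), if_pos (by omega)]
  par := fun k l h1 h2 h3 h4 h => by
    simp only [bs, syW]
    rw [if_neg (by omega), if_pos (by omega), if_neg (by omega), if_pos (by omega)]
    have : (m + R + 1 - k) % 2 = (m + R + 1 - l) % 2 := by omega
    simp [lt2, this]
  hend := fun s z z' d e h => by
    simp only [bs] at h
    have h1 := ((mF_some A).1 h).2.2
    cases e
    · rfl
    · exact absurd ⟨by simp [syW], rfl⟩ h1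
  hW1 := by
    have := Bd_grow (kap (A.Q1 × A.Q2)) (uB m R v) 0 (m + 1)
      (fun r h1 h2 => by simp only [uB]; split_ifs <;> omega)
    simp only [Bd_zero, zero_add] at this
    rw [hW]
    exact this
  hW2 := by
    have := Bd_grow (kap (A.Q1 × A.Q2)) (fun k => uB m R v (m + R + 1 - k)) (R + 1) m
      (fun r h1 h2 => by simp only [uB]; split_ifs <;> omega)
    rw [show R + 1 + m = m + R + 1 by omega] at this
    refine this.trans (Nat.add_le_add_left ?_ _)
    rw [hW]
    exact Nat.mul_le_mul_right _ (by omega)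
  hL := by
    have h1 : v ≤ kap (A.Q1 × A.Q2) * v := Nat.le_mul_of_pos_left _ kap_pos
    omega
  hv := by omega
  hR := hR
  R1 := hR1

/-- occurrence of the forbidden factor -/
def Bad (w : List Bool) : Prop :=
  ∃ i, tape w i = Sum.inl false ∧ tape w (i + 1) = Sum.inl true ∧ tape w (i + 2) = Sum.inl false

theorem main_rev (A : DPWK Bool) (Wit : RevWitness A) (h1 : ∀ w, ¬ Bad w → Accepts A w)
    (h2 : ∀ w, Bad w → ¬ Accepts A w) : False := by
  obtain ⟨G, hG⟩ : ∃ G, G = 6 + (kap (A.Q1 × A.Q2) * Fintype.card (A.Q1 × A.Q2) + 1) ^ 3 := ⟨_, rfl⟩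
  obtain ⟨m, hm⟩ : ∃ m, m = 2 * G + 2 := ⟨_, rfl⟩
  obtain ⟨W, hW⟩ : ∃ W, W = (m + 1) * (1 + kap (A.Q1 × A.Q2)) := ⟨_, rfl⟩
  obtain ⟨v, hv⟩ : ∃ v, v = (W + 1) * Fintype.card (A.Q1 × A.Q2) +
      kap (A.Q1 × A.Q2) * Fintype.card (A.Q1 × A.Q2) + 1 := ⟨_, rfl⟩
  obtain ⟨R, hR⟩ : ∃ R, R = 2 * (W * Fintype.card (A.Q1 × A.Q2)) + 1 := ⟨_, rfl⟩
  have hS := bs_setup A Wit m W R v (by omega) (by omega) hW hv (by omega)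
  have hκ := kap_pos (Z := A.Q1 × A.Q2)
  have hacc := h1 (wd (kap (A.Q1 × A.Q2)) (uB m R v) (m + R)) (by
    rintro ⟨i, e1, e2, e3⟩
    have hRL := wd_RL (kap (A.Q1 × A.Q2)) (uB m R v) (by simp [uB]) (m + R)
    obtain ⟨k, x, hx1, hx2⟩ := Bd_dec (kap (A.Q1 × A.Q2)) (uB m R v) (i + 1)
    have hs := hRL k x hx2
    rw [← hx1, e2] at hs
    have hk : k ≠ 0 ∧ k ≤ m + R := by
      unfold syW at hs
      split_ifs at hs
      exact ⟨by assumption, by assumption⟩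
    have hu : 1 ≤ uB m R v k := by
      unfold uB
      split_ifs <;> omega
    have hku := Nat.le_mul_of_pos_right (kap (A.Q1 × A.Q2)) hu
    rcases Nat.eq_zero_or_pos x with rfl | hx
    · have := hRL k 1 (by omega)
      rw [show Bd (kap (A.Q1 × A.Q2)) (uB m R v) k + 1 = i + 2 by omega, e3, ← hs] at this
      simp at this
    · have := hRL k (x - 1) (by omega)
      rw [show Bd (kap (A.Q1 × A.Q2)) (uB m R v) k + (x - 1) = i by omega, e1, ← hs] at this
      simp at this)
  obtain ⟨p, hp, q, hq, hne, hall⟩ := hS.final ((accepts_accF A _).1 hacc)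
    ((Finset.range G).image fun s => 2 * s + 2)
    (by
      intro p hp
      simp only [Finset.mem_image, Finset.mem_range] at hp
      obtain ⟨s, hs, rfl⟩ := hp
      exact ⟨by omega, by omega, by omega⟩)
    (by
      rw [Finset.card_image_of_injective _ (fun s t h => by simpa using h), Finset.card_range]
      omega)
  simp only [Finset.mem_image, Finset.mem_range] at hp hq
  obtain ⟨s, hs, rfl⟩ := hp
  obtain ⟨t, ht, rfl⟩ := hq
  have hM : Md (uB m R v) (uV (uB m R v) (2 * s + 2) (2 * t + 2)) (2 * s + 2) (2 * t + 2) :=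
    uV_Md _ hne (by simp only [uB]; split_ifs <;> omega) (by simp only [uB]; split_ifs <;> omega)
  have hu0 : uV (uB m R v) (2 * s + 2) (2 * t + 2) 0 = 0 := by
    rw [hM.eq 0 (by omega) (by omega)]; simp [uB]
  have huM : uV (uB m R v) (2 * s + 2) (2 * t + 2) (m + R + 1) = 0 := by
    rw [hM.eq _ (by omega) (by omega)]; simp only [uB]; split_ifs <;> omega
  have hup := hM.up'
  generalize uV (uB m R v) (2 * s + 2) (2 * t + 2) = u' at *
  have hA := hall u' (fun k => u' (m + R + 1 - k)) _ _
    ⟨⟨by omega, by omega, by omega⟩, ⟨by omega, by omega, by omega⟩, hM,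
      Md_rev hM (by omega) (by omega) (by omega) (by omega),
      wd_RL _ u' hu0 (m + R), wd_RL2 _ u' hu0 (m + R) huM⟩
  refine h2 (wd (kap (A.Q1 × A.Q2)) u' (m + R)) ?_ ((accepts_accF A _).2 hA)
  have hRL := wd_RL (kap (A.Q1 × A.Q2)) u' hu0 (m + R)
  have b1 : Bd (kap (A.Q1 × A.Q2)) u' (2 * s + 2) = _ :=
    Bd_succ (kap (A.Q1 × A.Q2)) u' (2 * s + 1)
  have b2 : Bd (kap (A.Q1 × A.Q2)) u' (2 * s + 3) = _ :=
    Bd_succ (kap (A.Q1 × A.Q2)) u' (2 * s + 2)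
  rw [hup] at b2
  have a1 := hRL (2 * s + 1) (kap (A.Q1 × A.Q2) * u' (2 * s + 1)) (by omega)
  have a2 := hRL (2 * s + 2) 0 (by omega)
  have a3 := hRL (2 * s + 3) 0 (by omega)
  refine ⟨Bd (kap (A.Q1 × A.Q2)) u' (2 * s + 1) + kap (A.Q1 × A.Q2) * u' (2 * s + 1), ?_, ?_, ?_⟩
  · rw [a1]
    simp only [syW]
    rw [if_neg (by omega), if_pos (by omega)]
    simp only [lt2]
    rw [decide_eq_false (by omega)]
  · rw [show Bd (kap (A.Q1 × A.Q2)) u' (2 * s + 1) + kap (A.Q1 × A.Q2) * u' (2 * s + 1) + 1 =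
      Bd (kap (A.Q1 × A.Q2)) u' (2 * s + 2) + 0 by omega, a2]
    simp only [syW]
    rw [if_neg (by omega), if_pos (by omega)]
    simp only [lt2]
    rw [decide_eq_true (by omega)]
  · rw [show Bd (kap (A.Q1 × A.Q2)) u' (2 * s + 1) + kap (A.Q1 × A.Q2) * u' (2 * s + 1) + 2 =
      Bd (kap (A.Q1 × A.Q2)) u' (2 * s + 3) + 0 by omega, a3]
    simp only [syW]
    rw [if_neg (by omega), if_pos (by omega)]
    simp only [lt2]
    rw [decide_eq_false (by omega)]

/-- automaton for the absence of the forbidden factor -/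
def stp (q : Fin 4) (s : TSym Bool) : Fin 4 :=
  if q = 3 then 3 else
    match s with
    | Sum.inr _ => 0
    | Sum.inl false => if q = 2 then 3 else 1
    | Sum.inl true => if q = 1 then 2 else 0

def dA : DPWK Bool where
  M := Unit
  Q1 := Fin 4
  Q2 := Unit
  fM := inferInstance
  fQ1 := inferInstance
  fQ2 := inferInstance
  δ1 := fun q s _ => if s = Sum.inr true then none else some (stp q s, true)
  δ2 := fun _ _ _ => some ((), false)
  μ1 := fun _ _ => none
  μ2 := fun _ _ => none
  q01 := (0 : Fin 4)
  q02 := ()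
  F1 := {q : Fin 4 | q ≠ 3}
  F2 := ∅

def sq (w : List Bool) : ℕ → Fin 4
  | 0 => 0
  | i + 1 => stp (sq w i) (tape w i)

def cf (w : List Bool) (i : ℕ) : Config dA := ⟨(sq w i : Fin 4), i, (), w.length + 1⟩

theorem step_cf (w : List Bool) (i : ℕ) (c' : Config dA) :
    Step dA w (cf w i) c' ↔ tape w i ≠ Sum.inr true ∧ c' = cf w (i + 1) := by
  obtain ⟨p, i', q, j⟩ := c'
  constructor
  · rintro ⟨d, e, h1, h2, h3, h4⟩
    simp only [dA, cf] at h1 h2 h3 h4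
    split_ifs at h1 with h5
    simp only [Option.some.injEq, Prod.mk.injEq] at h1 h2
    obtain ⟨rfl, rfl⟩ := h1
    obtain ⟨-, rfl⟩ := h2
    simp only [cond_true, cond_false, add_zero] at h3 h4
    subst h3 h4
    exact ⟨h5, rfl⟩
  · rintro ⟨h1, h2⟩
    rw [h2]
    refine ⟨true, false, ?_, rfl, rfl, rfl⟩
    simp only [dA, cf]
    rw [if_neg h1]
    rfl

theorem dA_accepts (w : List Bool) : Accepts dA w ↔ sq w (w.length + 1) ≠ 3 := by
  rw [accepts_iff]
  have h0 : initConf dA w = cf w 0 := rfl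
  rw [h0]
  constructor
  · rintro ⟨c, h1, h2, h3⟩
    have key : ∃ i, i ≤ w.length + 1 ∧ c = cf w i := by
      clear h2 h3
      induction h1 with
      | refl => exact ⟨0, by omega, rfl⟩
      | tail _ hs ih =>
        obtain ⟨i, hi, rfl⟩ := ih
        obtain ⟨h4, rfl⟩ := (step_cf w i _).1 hs
        have := mt tape_end.2 h4
        exact ⟨i + 1, by omega, rfl⟩
    obtain ⟨i, hi, rfl⟩ := key
    have hie : tape w i = Sum.inr true := by
      by_contra hne
      exact h2 ⟨_, (step_cf w i _).2 ⟨hne, rfl⟩⟩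
    have := tape_end.1 hie
    obtain rfl : i = w.length + 1 := by omega
    rcases h3 with h3 | h3
    · exact h3
    · exact False.elim h3
  · intro h
    refine ⟨cf w (w.length + 1), ?_, ?_, Or.inl h⟩
    · have key : ∀ i, i ≤ w.length + 1 → Relation.ReflTransGen (Step dA w) (cf w 0) (cf w i) := by
        intro i
        induction i with
        | zero => exact fun _ => .refl
        | succ i ih =>
          intro hi
          refine .tail (ih (by omega)) ((step_cf w i _).2 ⟨fun h => ?_, rfl⟩)
          have := tape_end.1 h
          omega
      exact key _ (le_refl _)
    · rintro ⟨c', hs⟩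
      exact ((step_cf w _ _).1 hs).1 (tape_end.2 (by omega))

theorem dA_good (w : List Bool) (h : ¬ Bad w) : Accepts dA w := by
  rw [dA_accepts]
  have key : ∀ i, sq w i ≠ 3 ∧ (sq w i = 1 → ∃ k, i = k + 1 ∧ tape w k = Sum.inl false) ∧
      (sq w i = 2 → ∃ k, i = k + 2 ∧ tape w k = Sum.inl false ∧
        tape w (k + 1) = Sum.inl true) := by
    intro i
    induction i with
    | zero => simp [sq]
    | succ i ih =>
      obtain ⟨a1, a2, a3⟩ := ih
      simp only [sq, stp]
      rw [if_neg a1]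
      rcases ht : tape w i with (_ | _) | b
      · simp only
        by_cases h2 : sq w i = 2
        · obtain ⟨k, rfl, e1, e2⟩ := a3 h2
          exact absurd ⟨k, e1, e2, ht⟩ h
        · rw [if_neg h2]
          exact ⟨by decide, fun _ => ⟨i, rfl, ht⟩, fun h => absurd h (by decide)⟩
      · simp only
        by_cases h2 : sq w i = 1
        · obtain ⟨k, rfl, e1⟩ := a2 h2
          rw [if_pos h2]
          exact ⟨by decide, fun h => absurd h (by decide), fun _ => ⟨k, rfl, e1, ht⟩⟩
        · rw [if_neg h2]
          exact ⟨by decide, fun h => absurd h (by decide), fun h => absurd h (by decide)⟩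
      · simp only
        exact ⟨by decide, fun h => absurd h (by decide), fun h => absurd h (by decide)⟩
  exact (key _).1

theorem dA_bad (w : List Bool) (h : Bad w) : ¬ Accepts dA w := by
  rw [dA_accepts, not_not]
  obtain ⟨i, e1, e2, e3⟩ := h
  have hi : sq w (i + 3) = 3 := by
    simp only [sq, e1, e2, e3]
    generalize sq w i = q
    revert q
    decide
  have key : ∀ d, sq w (i + 3 + d) = 3 := by
    intro d
    induction d with
    | zero => exact hi
    | succ d ih => rw [← add_assoc, sq, ih]; rfl
  have hlen : i + 2 ≤ w.length := by
    by_contra hlt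
    rw [tape_end.2 (by omega)] at e3
    simp at e3
  have := key (w.length + 1 - (i + 3))
  rwa [show i + 3 + (w.length + 1 - (i + 3)) = w.length + 1 by omega] at this

theorem dA_comm (w : List Bool) (cs : List (Config dA)) : commCount dA dA.μ1 dA.μ2 w cs = 0 := by
  unfold commCount
  have : stepMsgs dA dA.μ1 dA.μ2 w = fun _ => 0 := by
    funext c
    rfl
  rw [this]
  simp

theorem strict (f : ℕ → ℕ) : RevPWKLangsO Bool f ⊂ PWKLangsO Bool f := by
  rw [Set.ssubset_iff_of_subset]
  · refine ⟨lang dA, ⟨dA, 0, fun w hw => ?_, rfl⟩, ?_⟩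
    · obtain ⟨cs, hcs⟩ := hw
      exact ⟨cs, hcs, by rw [dA_comm]; omega⟩
    · rintro ⟨A, C, ⟨Wit, -⟩, hL⟩
      have hiff : ∀ w, Accepts A w ↔ Accepts dA w := fun w => Set.ext_iff.1 hL w
      exact main_rev A Wit (fun w h => (hiff w).2 (dA_good w h))
        (fun w h h' => dA_bad w h ((hiff w).1 h'))
  · rintro L ⟨A, C, ⟨Wit, h⟩, hL⟩
    refine ⟨A, C, fun w hw => ?_, hL⟩
    obtain ⟨cs, h1, h2, -⟩ := h w hw
    exact ⟨cs, h1, h2⟩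

end WKP


open WK in
/-- For each communication bound `f` among `O(1)`, `O(log n)`,
`O(√n)` and `O(n)`, the class of languages accepted by reversible two-party
Watson-Crick systems with communication bound `O(f)` is strictly contained in the
class accepted by general (possibly irreversible) deterministic two-party
Watson-Crick systems with communication bound `O(f)`. -/
theorem REV_PWK_strictly_weaker_than_DPWK (f : ℕ → ℕ)
    (hf : f = (fun _ => 1) ∨ f = (fun n => Nat.log 2 n) ∨ f = Nat.sqrt ∨
      f = (fun n => n)) :
    RevPWKLangsO Bool f ⊂ PWKLangsO Bool f := by
  exact WKP.strict f
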